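/- arXiv:1904.10950 — 4 statements merged into one kernel-verified Lean document; each statement's English description precedes it below -/
import Mathlib

section
/- Let κ, γ ∈ (0,1) and let ω : [0,1] → [0,∞) be nondecreasing with ω(0) = 0 and ∫_0^1 ω(s)/s ds < ∞. Define τ : [0,1] → [0,∞) by τ(t) := Σ_{i=1}^∞ κ^{iγ}·g(κ^{-i} t), where g(u) := ω(u) if u ≤ 1 and g(u) := ω(1) if u > 1. Then τ(0) = 0, τ(t) ≤ ω(1)·κ^γ/(1−κ^γ) for all t ∈ [0,1], τ is nondecreasing, and ∫_0^1 τ(t)/t dt < ∞. -/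
open MeasureTheory Set

/-- The function `τ(t) = ∑_{i=1}^∞ κ^{iγ} g(κ^{-i} t)` where `g(u) = ω(u)` for `u ≤ 1`
and `g(u) = ω(1)` for `u > 1`. -/
noncomputable def tau (κ γ : ℝ) (ω : ℝ → ℝ) (t : ℝ) : ℝ :=
  ∑' i : ℕ, κ ^ (((i : ℝ) + 1) * γ) *
    (if κ ^ (-((i : ℝ) + 1)) * t ≤ 1 then ω (κ ^ (-((i : ℝ) + 1)) * t) else ω 1)

/-- The clamped extension of `ω` from `[0, 1]` to the real line. -/
noncomputable def clampExtend (ω : ℝ → ℝ) (u : ℝ) : ℝ := ω (max 0 (min u 1))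

lemma max_zero_min_one_mem_Icc (u : ℝ) : max 0 (min u 1) ∈ Icc (0 : ℝ) 1 :=
  ⟨le_max_left _ _, max_le zero_le_one (min_le_right _ _)⟩

lemma monotone_clampExtend {ω : ℝ → ℝ} (hmono : MonotoneOn ω (Icc 0 1)) :
    Monotone (clampExtend ω) := fun _ _ h =>
  hmono (max_zero_min_one_mem_Icc _) (max_zero_min_one_mem_Icc _)
    (max_le_max le_rfl (min_le_min h le_rfl))

lemma clampExtend_nonneg {ω : ℝ → ℝ} (hnn : ∀ t ∈ Icc (0 : ℝ) 1, 0 ≤ ω t) (u : ℝ) :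
    0 ≤ clampExtend ω u := hnn _ (max_zero_min_one_mem_Icc u)

lemma clampExtend_le {ω : ℝ → ℝ} (hmono : MonotoneOn ω (Icc 0 1)) (u : ℝ) :
    clampExtend ω u ≤ ω 1 :=
  hmono (max_zero_min_one_mem_Icc u) (right_mem_Icc.2 zero_le_one) (max_zero_min_one_mem_Icc u).2

lemma clampExtend_of_mem {ω : ℝ → ℝ} {u : ℝ} (hu : u ∈ Icc (0 : ℝ) 1) :
    clampExtend ω u = ω u := by
  simp [clampExtend, hu.1, hu.2]

lemma ite_eq_clampExtend {ω : ℝ → ℝ} {u : ℝ} (hu : 0 ≤ u) :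
    (if u ≤ 1 then ω u else ω 1) = clampExtend ω u := by
  split_ifs with h
  · rw [clampExtend_of_mem ⟨hu, h⟩]
  · simp [clampExtend, (not_le.1 h).le]

lemma tau_eq_tsum {κ γ : ℝ} (hκ : 0 < κ) (ω : ℝ → ℝ) {t : ℝ} (ht : 0 ≤ t) :
    tau κ γ ω t = ∑' i : ℕ, (κ ^ γ) ^ (i + 1) * clampExtend ω (κ⁻¹ ^ (i + 1) * t) := by
  refine tsum_congr fun i => ?_
  have h₁ : κ ^ (((i : ℝ) + 1) * γ) = (κ ^ γ) ^ (i + 1) := by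
    rw [mul_comm, Real.rpow_mul hκ.le, ← Real.rpow_natCast (κ ^ γ)]
    push_cast
    rfl
  have h₂ : κ ^ (-((i : ℝ) + 1)) = κ⁻¹ ^ (i + 1) := by
    rw [Real.rpow_neg hκ.le, inv_pow, ← Real.rpow_natCast κ]
    push_cast
    rfl
  rw [h₁, h₂, ite_eq_clampExtend (by positivity)]

lemma summable_geometric_succ_mul_of_le {q M : ℝ} (hq₀ : 0 ≤ q) (hq₁ : q < 1) {f : ℕ → ℝ}
    (hf₀ : ∀ i, 0 ≤ f i) (hf : ∀ i, f i ≤ M) : Summable fun i => q ^ (i + 1) * f i :=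
  Summable.of_nonneg_of_le (fun i => mul_nonneg (by positivity) (hf₀ i))
    (fun i => mul_le_mul_of_nonneg_left (hf i) (by positivity))
    (((summable_nat_add_iff 1).2 (summable_geometric_of_lt_one hq₀ hq₁)).mul_right M)

lemma hasSum_geometric_succ {q : ℝ} (hq₀ : 0 ≤ q) (hq₁ : q < 1) :
    HasSum (fun i : ℕ => q ^ (i + 1)) (q / (1 - q)) := by
  simpa only [pow_succ', div_eq_mul_inv] using (hasSum_geometric_of_lt_one hq₀ hq₁).mul_left q

/-- The measure `dt / t` is invariant under dilations. -/
lemma setLIntegral_comp_mul_left_div (G : ℝ → ℝ) {c : ℝ} (hc : 0 < c) :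
    ∫⁻ t in Ioo (0 : ℝ) 1, ENNReal.ofReal (G (c * t) / t) =
      ∫⁻ u in Ioo (0 : ℝ) c, ENNReal.ofReal (G u / u) := by
  have himage : (fun t : ℝ => c * t) '' Ioo 0 1 = Ioo 0 c := by
    simp [Set.image_mul_left_Ioo hc]
  rw [← himage, lintegral_image_eq_lintegral_abs_deriv_mul measurableSet_Ioo
    (f' := fun _ => c) (fun t _ => by simpa using ((hasDerivAt_id t).const_mul c).hasDerivWithinAt)
    (mul_right_injective₀ hc.ne').injOn]
  refine setLIntegral_congr_fun measurableSet_Ioo fun t ht => ?_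
  have ht₀ : t ≠ 0 := ht.1.ne'
  rw [abs_of_pos hc, ← ENNReal.ofReal_mul hc.le]
  congr 1
  field_simp

lemma setLIntegral_div_mul_le {G : ℝ → ℝ} {M : ℝ} (hM : 0 ≤ M) (hG : ∀ u, G u ≤ M)
    {c : ℝ} (hc : 0 < c) (r : ℝ) :
    ∫⁻ u in Ioo (0 : ℝ) (r * c), ENNReal.ofReal (G u / u) ≤
      (∫⁻ u in Ioo (0 : ℝ) c, ENNReal.ofReal (G u / u)) + ENNReal.ofReal (M * (r - 1)) := by
  have htail : ∫⁻ u in Ico c (r * c), ENNReal.ofReal (G u / u) ≤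
      ENNReal.ofReal (M * (r - 1)) := by
    calc ∫⁻ u in Ico c (r * c), ENNReal.ofReal (G u / u)
        ≤ ∫⁻ _ in Ico c (r * c), ENNReal.ofReal (M / c) := by
          refine setLIntegral_mono measurable_const fun u hu => ENNReal.ofReal_le_ofReal ?_
          exact div_le_div₀ hM (hG u) hc hu.1
      _ = ENNReal.ofReal (M * (r - 1)) := by
          rw [setLIntegral_const, Real.volume_Ico, ← ENNReal.ofReal_mul (by positivity)]
          congr 1
          field_simp
  calc ∫⁻ u in Ioo (0 : ℝ) (r * c), ENNReal.ofReal (G u / u)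
      ≤ ∫⁻ u in Ioo (0 : ℝ) c ∪ Ico c (r * c), ENNReal.ofReal (G u / u) := by
        refine lintegral_mono_set fun u hu => ?_
        rcases lt_or_ge u c with h | h
        · exact Or.inl ⟨hu.1, h⟩
        · exact Or.inr ⟨h, hu.2⟩
    _ ≤ _ := (lintegral_union_le _ _ _).trans (by gcongr)

lemma setLIntegral_div_pow_le {G : ℝ → ℝ} {M : ℝ} (hM : 0 ≤ M) (hG : ∀ u, G u ≤ M)
    {r : ℝ} (hr : 1 ≤ r) (n : ℕ) :
    ∫⁻ u in Ioo (0 : ℝ) (r ^ n), ENNReal.ofReal (G u / u) ≤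
      (∫⁻ u in Ioo (0 : ℝ) 1, ENNReal.ofReal (G u / u)) + n * ENNReal.ofReal (M * (r - 1)) := by
  induction n with
  | zero => simp
  | succ n ih =>
    rw [pow_succ']
    refine (setLIntegral_div_mul_le hM hG (by positivity) r).trans ?_
    push_cast
    rw [add_mul, one_mul, ← add_assoc]
    gcongr

lemma tsum_ofReal_geometric_mul_affine_lt_top {q : ℝ} (hq₀ : 0 ≤ q) (hq₁ : q < 1)
    {D C : ENNReal} (hD : D ≠ ⊤) (hC : C ≠ ⊤) :
    ∑' i : ℕ, ENNReal.ofReal (q ^ (i + 1)) * (D + ((i + 1 : ℕ) : ENNReal) * C) < ⊤ := by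
  have hq : ‖q‖ < 1 := by rwa [Real.norm_of_nonneg hq₀]
  have hsum : Summable fun n : ℕ => q ^ n * (D.toReal + n * C.toReal) := by
    refine (((summable_geometric_of_lt_one hq₀ hq₁).mul_right D.toReal).add
      ((summable_pow_mul_geometric_of_norm_lt_one 1 hq).mul_right C.toReal)).congr fun n => ?_
    ring
  refine lt_of_eq_of_lt (tsum_congr fun i => ?_) ((summable_nat_add_iff 1).2 hsum).tsum_ofReal_lt_top
  rw [ENNReal.ofReal_mul (by positivity), ENNReal.ofReal_add (by positivity) (by positivity),
    ENNReal.ofReal_mul (by positivity), ENNReal.ofReal_toReal hD, ENNReal.ofReal_toReal hC,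
    ENNReal.ofReal_natCast]

/-- basic properties of `τ`. -/
theorem stmt_2 (κ γ : ℝ) (hκ : κ ∈ Set.Ioo (0 : ℝ) 1) (hγ : γ ∈ Set.Ioo (0 : ℝ) 1)
    (ω : ℝ → ℝ) (hmono : MonotoneOn ω (Set.Icc 0 1)) (hω0 : ω 0 = 0)
    (hnn : ∀ t ∈ Set.Icc (0 : ℝ) 1, 0 ≤ ω t)
    (hdini : (∫⁻ s in Set.Ioo (0 : ℝ) 1, ENNReal.ofReal (ω s / s)) < ⊤) :
    tau κ γ ω 0 = 0 ∧
    (∀ t ∈ Set.Icc (0 : ℝ) 1, tau κ γ ω t ≤ ω 1 * (κ ^ γ / (1 - κ ^ γ))) ∧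
    MonotoneOn (tau κ γ ω) (Set.Icc 0 1) ∧
    (∫⁻ t in Set.Ioo (0 : ℝ) 1, ENNReal.ofReal (tau κ γ ω t / t)) < ⊤ := by
  obtain ⟨hκ₀, hκ₁⟩ := hκ
  have hq₀ : 0 ≤ κ ^ γ := Real.rpow_nonneg hκ₀.le γ
  have hq₁ : κ ^ γ < 1 := Real.rpow_lt_one hκ₀.le hκ₁ hγ.1
  have hr : 1 ≤ κ⁻¹ := (one_le_inv₀ hκ₀).2 hκ₁.le
  have hω1 : 0 ≤ ω 1 := hnn 1 (right_mem_Icc.2 zero_le_one)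
  have hsum (t : ℝ) := summable_geometric_succ_mul_of_le hq₀ hq₁
    (fun i => clampExtend_nonneg hnn (κ⁻¹ ^ (i + 1) * t)) (fun i => clampExtend_le hmono _)
  refine ⟨?_, fun t ht => ?_, fun s hs t ht hst => ?_, ?_⟩
  · rw [tau_eq_tsum hκ₀ ω le_rfl]
    simp [clampExtend, hω0]
  · rw [tau_eq_tsum hκ₀ ω ht.1, mul_comm]
    have hgeom := (hasSum_geometric_succ hq₀ hq₁).mul_right (ω 1)
    rw [← hgeom.tsum_eq]
    exact (hsum t).tsum_le_tsum
      (fun i => mul_le_mul_of_nonneg_left (clampExtend_le hmono _) (by positivity)) hgeom.summable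
  · rw [tau_eq_tsum hκ₀ ω hs.1, tau_eq_tsum hκ₀ ω ht.1]
    refine (hsum s).tsum_le_tsum (fun i => ?_) (hsum t)
    exact mul_le_mul_of_nonneg_left (monotone_clampExtend hmono (by gcongr)) (by positivity)
  · have hD : ∫⁻ u in Ioo (0 : ℝ) 1, ENNReal.ofReal (clampExtend ω u / u) < ⊤ := by
      refine lt_of_eq_of_lt (setLIntegral_congr_fun measurableSet_Ioo fun u hu => ?_) hdini
      rw [clampExtend_of_mem ⟨hu.1.le, hu.2.le⟩]
    have hmeas := (monotone_clampExtend hmono).measurable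
    calc ∫⁻ t in Ioo (0 : ℝ) 1, ENNReal.ofReal (tau κ γ ω t / t)
        = ∫⁻ t in Ioo (0 : ℝ) 1, ∑' i : ℕ, ENNReal.ofReal ((κ ^ γ) ^ (i + 1)) *
            ENNReal.ofReal (clampExtend ω (κ⁻¹ ^ (i + 1) * t) / t) := by
          refine setLIntegral_congr_fun measurableSet_Ioo fun t ht => ?_
          rw [tau_eq_tsum hκ₀ ω ht.1.le, ← tsum_div_const, ENNReal.ofReal_tsum_of_nonneg
            (fun i => div_nonneg (mul_nonneg (by positivity) (clampExtend_nonneg hnn _)) ht.1.le)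
            ((hsum t).div_const t)]
          refine tsum_congr fun i => ?_
          rw [mul_div_assoc, ENNReal.ofReal_mul (by positivity)]
      _ = ∑' i : ℕ, ENNReal.ofReal ((κ ^ γ) ^ (i + 1)) *
            ∫⁻ t in Ioo (0 : ℝ) 1,
              ENNReal.ofReal (clampExtend ω (κ⁻¹ ^ (i + 1) * t) / t) := by
          rw [lintegral_tsum fun i => by fun_prop]
          exact tsum_congr fun i => lintegral_const_mul _ (by fun_prop)
      _ ≤ ∑' i : ℕ, ENNReal.ofReal ((κ ^ γ) ^ (i + 1)) *
            ((∫⁻ u in Ioo (0 : ℝ) 1, ENNReal.ofReal (clampExtend ω u / u)) +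
              ((i + 1 : ℕ) : ENNReal) * ENNReal.ofReal (ω 1 * (κ⁻¹ - 1))) := by
          refine ENNReal.tsum_le_tsum fun i => ?_
          rw [setLIntegral_comp_mul_left_div _ (by positivity)]
          gcongr
          exact setLIntegral_div_pow_le hω1 (clampExtend_le hmono) hr (i + 1)
      _ < ⊤ := tsum_ofReal_geometric_mul_affine_lt_top hq₀ hq₁ hD.ne ENNReal.ofReal_ne_top
end

section
/- Let κ, γ ∈ (0,1) and let ω : [0,1] → [0,∞) be nondecreasing with ω(t) ≤ (log(t/4))^{-2} = 1/(log(4/t))² for all t ∈ (0,1]. Define τ : [0,1] → [0,∞) by τ(t) := Σ_{i=1}^∞ κ^{iγ}·g(κ^{-i} t), where g(u) := ω(u) if u ≤ 1 and g(u) := ω(1) if u > 1. Then there exists a constant C > 0, depending only on κ and γ, such that for every r ∈ (0,1], ∫_0^r τ(t)/t dt ≤ C·(log(4/r))^{-1}. -/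
open MeasureTheory Set

lemma one_le_log_four_div {u : ℝ} (hu : u ∈ Ioc (0 : ℝ) 1) : 1 ≤ Real.log (4 / u) := by
  rw [Real.le_log_iff_exp_le (by have := hu.1; positivity), le_div_iff₀ hu.1]
  nlinarith [Real.exp_one_lt_d9, hu.1, hu.2, Real.exp_pos 1]

lemma summable_rpow_mul_sq {κ γ : ℝ} (hκ : κ ∈ Ioo (0 : ℝ) 1) (hγ : 0 < γ) (a : ℝ) :
    Summable fun i : ℕ => κ ^ (((i : ℝ) + 1) * γ) * (1 + ((i : ℝ) + 1) * a) ^ 2 := by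
  have hq0 : 0 < κ ^ γ := Real.rpow_pos_of_pos hκ.1 _
  have hq1 : ‖κ ^ γ‖ < 1 := by
    rw [Real.norm_of_nonneg hq0.le]
    exact Real.rpow_lt_one hκ.1.le hκ.2 hγ
  have h (k : ℕ) := summable_pow_mul_geometric_of_norm_lt_one k hq1
  have hs : Summable fun n : ℕ => (κ ^ γ) ^ n * (1 + (n : ℝ) * a) ^ 2 := by
    refine (((h 0).add ((h 1).mul_left (2 * a))).add ((h 2).mul_left (a ^ 2))).congr ?_
    intro n
    ring
  refine ((summable_nat_add_iff 1).2 hs).congr ?_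
  intro n
  rw [← Real.rpow_natCast, ← Real.rpow_mul hκ.1.le, mul_comm γ]
  push_cast
  rfl

/-- The truncated modulus at scale `κ ^ (-s) * t` loses at most a quadratic factor in `s`. -/
lemma truncated_le {κ : ℝ} (hκ : κ ∈ Ioo (0 : ℝ) 1) {ω : ℝ → ℝ}
    (hω : ∀ t ∈ Ioc (0 : ℝ) 1, ω t ≤ 1 / (Real.log (4 / t)) ^ 2) {s t : ℝ} (hs : 0 ≤ s)
    (ht : t ∈ Ioc (0 : ℝ) 1) :
    (if κ ^ (-s) * t ≤ 1 then ω (κ ^ (-s) * t) else ω 1) ≤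
      (1 + s * -Real.log κ) ^ 2 * (1 / (Real.log (4 / t)) ^ 2) := by
  have hL := one_le_log_four_div ht
  have ha : 0 < -Real.log κ := neg_pos.2 (Real.log_neg hκ.1 hκ.2)
  have hsa : 0 ≤ s * -Real.log κ := by positivity
  have hp : 0 < κ ^ (-s) := Real.rpow_pos_of_pos hκ.1 _
  have hlog : Real.log (κ ^ (-s) * t) = s * -Real.log κ + Real.log t := by
    rw [Real.log_mul hp.ne' ht.1.ne', Real.log_rpow hκ.1]
    ring
  have key : ∀ v ∈ Ioc (0 : ℝ) 1,
      Real.log (4 / t) ≤ Real.log (4 / v) + s * -Real.log κ →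
      ω v ≤ (1 + s * -Real.log κ) ^ 2 * (1 / (Real.log (4 / t)) ^ 2) := by
    intro v hv h
    have hl := one_le_log_four_div hv
    refine (hω v hv).trans ?_
    rw [mul_one_div, div_le_div_iff₀ (by positivity) (by positivity), one_mul, ← mul_pow]
    refine pow_le_pow_left₀ (by linarith) ?_ 2
    nlinarith
  rw [Real.log_div (by norm_num) ht.1.ne'] at key
  split_ifs with h
  · have hu : 0 < κ ^ (-s) * t := mul_pos hp ht.1
    rw [Real.log_div (by norm_num) ht.1.ne']
    refine key _ ⟨hu, h⟩ ?_
    rw [Real.log_div (by norm_num) hu.ne', hlog]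
    linarith
  · rw [Real.log_div (by norm_num) ht.1.ne']
    refine key 1 (by simp) ?_
    have := Real.log_pos (not_le.1 h)
    rw [hlog] at this
    rw [div_one]
    linarith

lemma tau_le {κ γ : ℝ} (hκ : κ ∈ Ioo (0 : ℝ) 1) (hγ : 0 < γ) {ω : ℝ → ℝ}
    (h0 : ∀ t ∈ Icc (0 : ℝ) 1, 0 ≤ ω t)
    (hω : ∀ t ∈ Ioc (0 : ℝ) 1, ω t ≤ 1 / (Real.log (4 / t)) ^ 2) {t : ℝ}
    (ht : t ∈ Ioc (0 : ℝ) 1) :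
    tau κ γ ω t ≤
      (∑' i : ℕ, κ ^ (((i : ℝ) + 1) * γ) * (1 + ((i : ℝ) + 1) * -Real.log κ) ^ 2) *
        (1 / (Real.log (4 / t)) ^ 2) := by
  have hS := (summable_rpow_mul_sq hκ hγ (-Real.log κ)).mul_right
    (1 / (Real.log (4 / t)) ^ 2)
  have hle (i : ℕ) : κ ^ (((i : ℝ) + 1) * γ) *
      (if κ ^ (-((i : ℝ) + 1)) * t ≤ 1 then ω (κ ^ (-((i : ℝ) + 1)) * t) else ω 1) ≤
      κ ^ (((i : ℝ) + 1) * γ) * (1 + ((i : ℝ) + 1) * -Real.log κ) ^ 2 *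
        (1 / (Real.log (4 / t)) ^ 2) := by
    rw [mul_assoc]
    exact mul_le_mul_of_nonneg_left (truncated_le hκ hω (by positivity) ht)
      (Real.rpow_nonneg hκ.1.le _)
  have hnn (i : ℕ) : 0 ≤ κ ^ (((i : ℝ) + 1) * γ) *
      (if κ ^ (-((i : ℝ) + 1)) * t ≤ 1 then ω (κ ^ (-((i : ℝ) + 1)) * t) else ω 1) := by
    refine mul_nonneg (Real.rpow_nonneg hκ.1.le _) ?_
    split_ifs with h
    · exact h0 _ ⟨mul_nonneg (Real.rpow_nonneg hκ.1.le _) ht.1.le, h⟩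
    · exact h0 1 (by simp)
  rw [← tsum_mul_right]
  exact (hS.of_nonneg_of_le hnn hle).tsum_le_tsum hle hS

/-- `t ↦ 1 / (t * log (4 / t) ^ 2)` has the antiderivative `(log (4 / t))⁻¹`, which vanishes
at `0`. -/
lemma lintegral_one_div_log_sq_div {r : ℝ} (hr : r ∈ Ioc (0 : ℝ) 1) :
    ∫⁻ t in Ioo (0 : ℝ) r, ENNReal.ofReal (1 / (Real.log (4 / t)) ^ 2 / t) =
      ENNReal.ofReal (Real.log (4 / r))⁻¹ := by
  have hderiv : ∀ t ∈ Ioc (0 : ℝ) r,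
      HasDerivAt (fun t : ℝ => (Real.log (4 / t))⁻¹) (1 / (Real.log (4 / t)) ^ 2 / t) t := by
    intro t ht
    have hL := one_le_log_four_div ⟨ht.1, ht.2.trans hr.2⟩
    have ht0 := ht.1.ne'
    have hdiv : HasDerivAt (fun t : ℝ => 4 / t) (-4 / t ^ 2) t := by
      simpa using (hasDerivAt_const t (4 : ℝ)).fun_div (hasDerivAt_id' t) ht0
    refine ((hdiv.log (by positivity)).fun_inv (by positivity)).congr_deriv ?_
    field_simp
  have hcont : ContinuousOn (fun t : ℝ => (Real.log (4 / t))⁻¹) (Icc 0 r) := by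
    intro t ht
    rcases ht.1.eq_or_lt with rfl | h
    · rw [← continuousWithinAt_sdiff_self]
      have hlim : Filter.Tendsto (fun t : ℝ => (Real.log (4 / t))⁻¹) (nhdsWithin 0 (Ioi 0))
          (nhds 0) :=
        (Real.tendsto_log_atTop.comp
          (tendsto_inv_nhdsGT_zero.const_mul_atTop (by norm_num : (0 : ℝ) < 4))).inv_tendsto_atTop
      simp only [ContinuousWithinAt, div_zero, Real.log_zero, inv_zero]
      exact hlim.mono_left (nhdsWithin_mono _ fun x hx => lt_of_le_of_ne hx.1.1 (Ne.symm hx.2))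
    · exact (hderiv t ⟨h, ht.2⟩).continuousAt.continuousWithinAt
  have hd : ∀ t ∈ Ioo (0 : ℝ) r,
      HasDerivAt (fun t : ℝ => (Real.log (4 / t))⁻¹) (1 / (Real.log (4 / t)) ^ 2 / t) t :=
    fun t ht => hderiv t ⟨ht.1, ht.2.le⟩
  have hnn : ∀ t ∈ Ioo (0 : ℝ) r, 0 ≤ 1 / (Real.log (4 / t)) ^ 2 / t := fun t ht => by
    have := ht.1
    positivity
  have hint := intervalIntegral.integrableOn_deriv_of_nonneg hcont hd hnn
  have hI := intervalIntegral.integral_eq_sub_of_hasDerivAt_of_le hr.1.le hcont hd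
    ((intervalIntegrable_iff_integrableOn_Ioc_of_le hr.1.le).2 hint)
  rw [intervalIntegral.integral_of_le hr.1.le, integral_Ioc_eq_integral_Ioo] at hI
  rw [← ofReal_integral_eq_lintegral_ofReal (hint.mono_set Ioo_subset_Ioc_self)
    ((ae_restrict_iff' measurableSet_Ioo).2 (.of_forall hnn)), hI]
  simp

/-- logarithmic Dini bound for `τ` when `ω(t) ≤ (log(4/t))⁻²`. -/
theorem stmt_6 (κ γ : ℝ) (hκ : κ ∈ Set.Ioo (0 : ℝ) 1) (hγ : γ ∈ Set.Ioo (0 : ℝ) 1) :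
    ∃ C : ℝ, 0 < C ∧
      ∀ ω : ℝ → ℝ, MonotoneOn ω (Set.Icc 0 1) →
        (∀ t ∈ Set.Icc (0 : ℝ) 1, 0 ≤ ω t) →
        (∀ t ∈ Set.Ioc (0 : ℝ) 1, ω t ≤ 1 / (Real.log (4 / t)) ^ 2) →
        ∀ r ∈ Set.Ioc (0 : ℝ) 1,
          (∫⁻ t in Set.Ioo (0 : ℝ) r, ENNReal.ofReal (tau κ γ ω t / t)) ≤
            ENNReal.ofReal (C * (Real.log (4 / r))⁻¹) := by
  set S := ∑' i : ℕ, κ ^ (((i : ℝ) + 1) * γ) * (1 + ((i : ℝ) + 1) * -Real.log κ) ^ 2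
  have hS : 0 ≤ S := tsum_nonneg fun i => mul_nonneg (Real.rpow_nonneg hκ.1.le _) (sq_nonneg _)
  refine ⟨S + 1, by positivity, fun ω _ h0 hω r hr => ?_⟩
  calc ∫⁻ t in Ioo (0 : ℝ) r, ENNReal.ofReal (tau κ γ ω t / t)
      ≤ ∫⁻ t in Ioo (0 : ℝ) r,
          ENNReal.ofReal (S + 1) * ENNReal.ofReal (1 / (Real.log (4 / t)) ^ 2 / t) := by
        refine setLIntegral_mono' measurableSet_Ioo fun t ht => ?_
        rw [← ENNReal.ofReal_mul (by positivity), ← mul_div_assoc]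
        refine ENNReal.ofReal_le_ofReal (div_le_div_of_nonneg_right ?_ ht.1.le)
        refine (tau_le hκ hγ.1 h0 hω ⟨ht.1, ht.2.le.trans hr.2⟩).trans ?_
        exact mul_le_mul_of_nonneg_right (by linarith) (by positivity)
    _ = ENNReal.ofReal ((S + 1) * (Real.log (4 / r))⁻¹) := by
        rw [lintegral_const_mul' _ _ ENNReal.ofReal_ne_top, lintegral_one_div_log_sq_div hr,
          ENNReal.ofReal_mul (by positivity)]
end

section
/- Let n ≥ 2, δ ∈ (0,1), Λ > 0, and let ā : ℝ → ℝ^{n×n} be measurable with values in symmetric matrices satisfying δ|ξ|² ≤ ā(s)ξ·ξ for all ξ ∈ ℝⁿ, s ∈ ℝ, and with all entries bounded in absolute value by Λ. Let u : B₁ → ℝ be Lipschitz on B₁ and differentiable at every point of B₁, and suppose that ∫_{B₁} ⟨ā(xⁿ) ∇u(x), ∇φ(x)⟩ dx = 0 for every smooth compactly supported φ : ℝⁿ → ℝ with support contained in B₁ (here xⁿ is the last coordinate of x). Then for every p ∈ (0,∞) there exists a constant C = C(n, p, δ, Λ) such that for every c ∈ ℝ, the restriction of u to B_{1/2} is Lipschitz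 with Lipschitz constant at most C·(∫_{B₁} |u − c|^p dx)^{1/p}. -/
open MeasureTheory Metric Set Matrix

section LocallyLipschitzFunctions

variable {E : Type*} [NormedAddCommGroup E] {f g : E → ℝ}

theorem LocallyLipschitz.real_mul (hf : LocallyLipschitz f) (hg : LocallyLipschitz g) :
    LocallyLipschitz fun x => f x * g x :=
  (ContDiff.locallyLipschitz (𝕂 := ℝ) (f := fun p : ℝ × ℝ => p.1 * p.2) (by fun_prop)).comp
    (hf.prodMk hg)

theorem LocallyLipschitz.real_const_mul (c : ℝ) (hf : LocallyLipschitz f) :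
    LocallyLipschitz fun x => c * f x :=
  (LocallyLipschitz.const c).real_mul hf

theorem LocallyLipschitz.finset_sum {ι : Type*} (s : Finset ι) {F : ι → E → ℝ}
    (hF : ∀ i ∈ s, LocallyLipschitz (F i)) : LocallyLipschitz fun x => ∑ i ∈ s, F i x := by
  classical
  induction s using Finset.induction_on with
  | empty => simpa using LocallyLipschitz.const (0 : ℝ)
  | insert i s hi ih =>
    simp only [Finset.sum_insert hi]
    exact (hF i (by simp)).add (ih fun j hj => hF j (by simp [hj]))

variable [NormedSpace ℝ E] [FiniteDimensional ℝ E]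

theorem LocallyLipschitz.exists_lipschitzOnWith_closedBall (hf : LocallyLipschitz f) (x : E)
    (R : ℝ) : ∃ K, LipschitzOnWith K f (closedBall x R) := by
  have : ProperSpace E := FiniteDimensional.proper ℝ E
  exact (hf.locallyLipschitzOn).exists_lipschitzOnWith_of_compact (isCompact_closedBall x R)

theorem LocallyLipschitz.exists_norm_fderiv_le (hf : LocallyLipschitz f) {s : Set E}
    (hs : IsCompact s) : ∃ C : ℝ, 0 ≤ C ∧ ∀ x ∈ s, ‖fderiv ℝ f x‖ ≤ C := by
  obtain ⟨R, hR⟩ := hs.isBounded.subset_closedBall 0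
  obtain ⟨K, hK⟩ := hf.exists_lipschitzOnWith_closedBall 0 (R + 1)
  refine ⟨K, K.2, fun x hx => norm_fderiv_le_of_lipschitzOn ℝ ?_ hK⟩
  have hx' : x ∈ ball (0 : E) (R + 1) := by
    have := hR hx
    rw [mem_closedBall] at this
    rw [mem_ball]
    linarith
  exact Filter.mem_of_superset (isOpen_ball.mem_nhds hx') ball_subset_closedBall

theorem LocallyLipschitz.exists_lipschitzWith_of_hasCompactSupport (hf : LocallyLipschitz f)
    (hc : HasCompactSupport f) : ∃ K, LipschitzWith K f := by
  obtain ⟨R, hR⟩ := hc.isCompact.isBounded.subset_closedBall 0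
  obtain ⟨K, hK⟩ := hf.exists_lipschitzOnWith_closedBall 0 (R + 1)
  obtain ⟨M, hM⟩ := hc.exists_bound_of_continuous hf.continuous
  have hM0 : 0 ≤ M := (norm_nonneg _).trans (hM 0)
  have hz : ∀ x, x ∉ closedBall (0 : E) R → f x = 0 := fun x hx =>
    image_eq_zero_of_notMem_tsupport fun h => hx (hR h)
  have key : ∀ x y, x ∈ closedBall (0 : E) R → |f x - f y| ≤ (K + M) * dist x y := by
    intro x y hx
    by_cases hy : y ∈ closedBall (0 : E) (R + 1)
    · have := hK.dist_le_mul x (closedBall_subset_closedBall (by linarith) hx) y hy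
      rw [Real.dist_eq] at this
      nlinarith [dist_nonneg (x := x) (y := y)]
    · have h1 : 1 ≤ dist x y := by
        rw [mem_closedBall] at hx hy
        have := dist_triangle y x 0
        rw [dist_comm y x] at this
        linarith
      rw [hz y fun h => hy (closedBall_subset_closedBall (by linarith) h), sub_zero]
      have := hM x
      rw [Real.norm_eq_abs] at this
      nlinarith [K.2, NNReal.coe_nonneg K]
  refine ⟨⟨K + M, add_nonneg K.2 hM0⟩, LipschitzWith.of_dist_le_mul fun x y => ?_⟩
  rw [Real.dist_eq]
  by_cases hx : x ∈ closedBall (0 : E) R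
  · exact key x y hx
  · by_cases hy : y ∈ closedBall (0 : E) R
    · rw [abs_sub_comm, dist_comm]
      exact key y x hy
    · rw [hz x hx, hz y hy]
      rw [sub_zero, abs_zero]
      exact mul_nonneg (add_nonneg K.2 hM0) dist_nonneg

variable [MeasurableSpace E] [BorelSpace E] {μ : Measure E} [μ.IsAddHaarMeasure]

theorem LocallyLipschitz.ae_differentiableAt (hf : LocallyLipschitz f) :
    ∀ᵐ x ∂μ, DifferentiableAt ℝ f x := by
  have h : ∀ k : ℕ, ∀ᵐ x ∂μ, x ∈ closedBall (0 : E) k →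
      DifferentiableWithinAt ℝ f (closedBall 0 k) x := fun k => by
    obtain ⟨K, hK⟩ := hf.exists_lipschitzOnWith_closedBall 0 k
    exact hK.ae_differentiableWithinAt_of_mem
  filter_upwards [ae_all_iff.2 h] with x hx
  obtain ⟨k, hk⟩ := exists_nat_gt ‖x‖
  have hk' : x ∈ ball (0 : E) k := by simpa using hk
  exact (hx k (ball_subset_closedBall hk')).differentiableAt
    (Filter.mem_of_superset (isOpen_ball.mem_nhds hk') ball_subset_closedBall)

end LocallyLipschitzFunctions

/-- A measurable function that is bounded on compact sets. -/
structure IsLocBounded {E : Type*} [TopologicalSpace E] [MeasurableSpace E] (g : E → ℝ) :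
    Prop where
  measurable : Measurable g
  bounded : ∀ s : Set E, IsCompact s → ∃ C : ℝ, ∀ x ∈ s, |g x| ≤ C

namespace IsLocBounded

variable {E : Type*} [TopologicalSpace E] [MeasurableSpace E] {f g : E → ℝ}

theorem of_continuous [OpensMeasurableSpace E] (hg : Continuous g) : IsLocBounded g where
  measurable := hg.measurable
  bounded s hs := by
    obtain ⟨C, hC⟩ := hs.exists_bound_of_continuousOn hg.continuousOn
    exact ⟨C, hC⟩

theorem const (c : ℝ) : IsLocBounded fun _ : E => c where
  measurable := measurable_const
  bounded _ _ := ⟨|c|, fun _ _ => le_rfl⟩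

theorem mul (hf : IsLocBounded f) (hg : IsLocBounded g) : IsLocBounded fun x => f x * g x where
  measurable := hf.measurable.mul hg.measurable
  bounded s hs := by
    obtain ⟨C, hC⟩ := hf.bounded s hs
    obtain ⟨D, hD⟩ := hg.bounded s hs
    refine ⟨C * D, fun x hx => ?_⟩
    rw [abs_mul]
    exact mul_le_mul (hC x hx) (hD x hx) (abs_nonneg _) ((abs_nonneg _).trans (hC x hx))

theorem add (hf : IsLocBounded f) (hg : IsLocBounded g) : IsLocBounded fun x => f x + g x where
  measurable := hf.measurable.add hg.measurable
  bounded s hs := by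
    obtain ⟨C, hC⟩ := hf.bounded s hs
    obtain ⟨D, hD⟩ := hg.bounded s hs
    exact ⟨C + D, fun x hx => (abs_add_le _ _).trans (add_le_add (hC x hx) (hD x hx))⟩

theorem const_mul (c : ℝ) (hf : IsLocBounded f) : IsLocBounded fun x => c * f x :=
  (const c).mul hf

theorem finset_sum {ι : Type*} (s : Finset ι) {F : ι → E → ℝ}
    (hF : ∀ i ∈ s, IsLocBounded (F i)) : IsLocBounded fun x => ∑ i ∈ s, F i x := by
  classical
  induction s using Finset.induction_on with
  | empty => simpa using const (E := E) 0
  | insert i s hi ih =>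
    simp only [Finset.sum_insert hi]
    exact (hF i (by simp)).add (ih fun j hj => hF j (by simp [hj]))

theorem integrable [T2Space E] [OpensMeasurableSpace E] {μ : Measure E}
    [IsFiniteMeasureOnCompacts μ] (hf : IsLocBounded f)
    {s : Set E} (hs : IsCompact s) (hz : ∀ x, x ∉ s → f x = 0) : Integrable f μ := by
  obtain ⟨C, hC⟩ := hf.bounded s hs
  have h1 : IntegrableOn f s μ :=
    IntegrableOn.of_bound hs.measure_lt_top hf.measurable.aestronglyMeasurable C
      (ae_restrict_of_forall_mem hs.measurableSet hC)
  exact (integrableOn_iff_integrable_of_support_subset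
    fun x hx => by_contra fun h => hx (hz x h)).1 h1

end IsLocBounded

/-- Symmetric, measurable, uniformly elliptic and bounded coefficients depending on one variable. -/
structure EllipticCoeff {n : ℕ} (δ Λ : ℝ) (a : ℝ → Matrix (Fin n) (Fin n) ℝ) : Prop where
  delta_pos : 0 < δ
  measurable : ∀ i j, Measurable fun s => a s i j
  symm : ∀ s i j, a s i j = a s j i
  elliptic : ∀ (s : ℝ) (ξ : Fin n → ℝ), δ * ∑ i, ξ i ^ 2 ≤ ∑ i, ∑ j, a s i j * ξ i * ξ j
  bound : ∀ s i j, |a s i j| ≤ Λ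

section EnergyForm

variable {n : ℕ}

/-- The bilinear form `(L, M) ↦ a(xᴺ) L · M` on the dual space at the point `x`. -/
noncomputable def energyForm (a : ℝ → Matrix (Fin n) (Fin n) ℝ) (N : Fin n)
    (x : EuclideanSpace ℝ (Fin n)) :
    (EuclideanSpace ℝ (Fin n) →L[ℝ] ℝ) →ₗ[ℝ] (EuclideanSpace ℝ (Fin n) →L[ℝ] ℝ) →ₗ[ℝ] ℝ :=
  LinearMap.mk₂ ℝ (fun L M => ∑ i, ∑ j, a (x N) i j * L (EuclideanSpace.single j 1) *
      M (EuclideanSpace.single i 1))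
    (fun L L' M => by simp [mul_add, add_mul, Finset.sum_add_distrib])
    (fun c L M => by
      simp only [smul_eq_mul, _root_.smul_apply, Finset.mul_sum]
      exact Finset.sum_congr rfl fun i _ => Finset.sum_congr rfl fun j _ => by ring)
    (fun L M M' => by simp [mul_add, Finset.sum_add_distrib])
    (fun c L M => by
      simp only [smul_eq_mul, _root_.smul_apply, Finset.mul_sum]
      exact Finset.sum_congr rfl fun i _ => Finset.sum_congr rfl fun j _ => by ring)

variable {a : ℝ → Matrix (Fin n) (Fin n) ℝ} {N : Fin n} {δ Λ : ℝ}

theorem energyForm_apply (x : EuclideanSpace ℝ (Fin n)) (L M : EuclideanSpace ℝ (Fin n) →L[ℝ] ℝ) :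
    energyForm a N x L M = ∑ i, ∑ j, a (x N) i j * L (EuclideanSpace.single j 1) *
      M (EuclideanSpace.single i 1) :=
  LinearMap.mk₂_apply _ _ _ _

theorem EllipticCoeff.energyForm_comm (ha : EllipticCoeff δ Λ a) (x : EuclideanSpace ℝ (Fin n))
    (L M : EuclideanSpace ℝ (Fin n) →L[ℝ] ℝ) : energyForm a N x L M = energyForm a N x M L := by
  rw [energyForm_apply, energyForm_apply, Finset.sum_comm]
  refine Finset.sum_congr rfl fun i _ => Finset.sum_congr rfl fun j _ => ?_
  rw [ha.symm]
  ring

theorem norm_sq_le_sum_single (L : EuclideanSpace ℝ (Fin n) →L[ℝ] ℝ) :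
    ‖L‖ ^ 2 ≤ ∑ i, L (EuclideanSpace.single i 1) ^ 2 := by
  have h0 : 0 ≤ ∑ i, L (EuclideanSpace.single i 1) ^ 2 := Finset.sum_nonneg fun i _ => sq_nonneg _
  have : ‖L‖ ≤ Real.sqrt (∑ i, L (EuclideanSpace.single i 1) ^ 2) := by
    refine L.opNorm_le_bound (Real.sqrt_nonneg _) fun x => ?_
    have hx : L x = ∑ i, x i * L (EuclideanSpace.single i 1) := by
      conv_lhs => rw [← (EuclideanSpace.basisFun (Fin n) ℝ).sum_repr x]
      simp
    rw [EuclideanSpace.norm_eq, ← Real.sqrt_mul h0, hx, Real.norm_eq_abs]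
    apply Real.abs_le_sqrt
    simp only [Real.norm_eq_abs, sq_abs]
    rw [mul_comm]
    exact Finset.sum_mul_sq_le_sq_mul_sq _ _ _
  calc ‖L‖ ^ 2 ≤ Real.sqrt (∑ i, L (EuclideanSpace.single i 1) ^ 2) ^ 2 := by gcongr
    _ = _ := Real.sq_sqrt h0

theorem EllipticCoeff.mul_norm_sq_le_energyForm (ha : EllipticCoeff δ Λ a)
    (x : EuclideanSpace ℝ (Fin n)) (L : EuclideanSpace ℝ (Fin n) →L[ℝ] ℝ) :
    δ * ‖L‖ ^ 2 ≤ energyForm a N x L L := by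
  refine (mul_le_mul_of_nonneg_left (norm_sq_le_sum_single L) ha.delta_pos.le).trans ?_
  refine (ha.elliptic (x N) fun i => L (EuclideanSpace.single i 1)).trans (le_of_eq ?_)
  rw [energyForm_apply]
  exact Finset.sum_congr rfl fun i _ => Finset.sum_congr rfl fun j _ => by ring

theorem EllipticCoeff.energyForm_nonneg (ha : EllipticCoeff δ Λ a)
    (x : EuclideanSpace ℝ (Fin n)) (L : EuclideanSpace ℝ (Fin n) →L[ℝ] ℝ) :
    0 ≤ energyForm a N x L L :=
  (mul_nonneg ha.delta_pos.le (sq_nonneg _)).trans (ha.mul_norm_sq_le_energyForm x L)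

theorem abs_apply_single_le (L : EuclideanSpace ℝ (Fin n) →L[ℝ] ℝ) (i : Fin n) :
    |L (EuclideanSpace.single i 1)| ≤ ‖L‖ := by
  simpa using L.le_opNorm (EuclideanSpace.single i (1 : ℝ))

theorem EllipticCoeff.bound_nonneg (ha : EllipticCoeff δ Λ a) (i : Fin n) : 0 ≤ Λ :=
  (abs_nonneg _).trans (ha.bound 0 i i)

theorem EllipticCoeff.abs_energyForm_le (ha : EllipticCoeff δ Λ a)
    (x : EuclideanSpace ℝ (Fin n)) (L M : EuclideanSpace ℝ (Fin n) →L[ℝ] ℝ) :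
    |energyForm a N x L M| ≤ n ^ 2 * Λ * ‖L‖ * ‖M‖ := by
  rw [energyForm_apply]
  calc |∑ i, ∑ j, a (x N) i j * L (EuclideanSpace.single j 1) * M (EuclideanSpace.single i 1)|
      ≤ ∑ i, ∑ j, |a (x N) i j * L (EuclideanSpace.single j 1) *
        M (EuclideanSpace.single i 1)| :=
        (Finset.abs_sum_le_sum_abs _ _).trans
          (Finset.sum_le_sum fun i _ => Finset.abs_sum_le_sum_abs _ _)
    _ ≤ ∑ _i : Fin n, ∑ _j : Fin n, Λ * ‖L‖ * ‖M‖ := by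
        refine Finset.sum_le_sum fun i _ => Finset.sum_le_sum fun j _ => ?_
        rw [abs_mul, abs_mul]
        have := ha.bound_nonneg i
        exact mul_le_mul (mul_le_mul (ha.bound _ _ _) (abs_apply_single_le L j) (abs_nonneg _) this)
          (abs_apply_single_le M i) (abs_nonneg _) (by positivity)
    _ = n ^ 2 * Λ * ‖L‖ * ‖M‖ := by simp; ring

theorem EllipticCoeff.measurable_energyForm (ha : EllipticCoeff δ Λ a) {X : Type*}
    [MeasurableSpace X] {p : X → EuclideanSpace ℝ (Fin n)} (hp : Measurable p)
    {F G : X → EuclideanSpace ℝ (Fin n) →L[ℝ] ℝ} (hF : Measurable F) (hG : Measurable G) :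
    Measurable fun x => energyForm a N (p x) (F x) (G x) := by
  simp only [energyForm_apply]
  refine Finset.measurable_fun_sum _ fun i _ => Finset.measurable_fun_sum _ fun j _ => ?_
  refine Measurable.mul (Measurable.mul ?_ ?_) ?_
  · exact (ha.measurable i j).comp ((by fun_prop : Measurable
      fun y : EuclideanSpace ℝ (Fin n) => y N).comp hp)
  · exact (ContinuousLinearMap.measurable_apply _).comp hF
  · exact (ContinuousLinearMap.measurable_apply _).comp hG

theorem EllipticCoeff.isLocBounded_energyForm (ha : EllipticCoeff δ Λ a)
    {f g : EuclideanSpace ℝ (Fin n) → ℝ} (hf : LocallyLipschitz f) (hg : LocallyLipschitz g) :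
    IsLocBounded fun x => energyForm a N x (fderiv ℝ f x) (fderiv ℝ g x) where
  measurable := ha.measurable_energyForm measurable_id (measurable_fderiv ℝ f)
    (measurable_fderiv ℝ g)
  bounded s hs := by
    obtain ⟨C, hC0, hC⟩ := hf.exists_norm_fderiv_le hs
    obtain ⟨D, hD0, hD⟩ := hg.exists_norm_fderiv_le hs
    refine ⟨n ^ 2 * Λ * C * D, fun x hx => (ha.abs_energyForm_le x _ _).trans ?_⟩
    have := ha.bound_nonneg N
    gcongr
    exacts [hC x hx, hD x hx]

end EnergyForm

section WeakEquation

variable {n : ℕ}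

/-- `div (a(xᴺ) ∇f) = g` weakly on `V`, tested against locally Lipschitz functions. -/
def WeakEq (a : ℝ → Matrix (Fin n) (Fin n) ℝ) (N : Fin n) (V : Set (EuclideanSpace ℝ (Fin n)))
    (f g : EuclideanSpace ℝ (Fin n) → ℝ) : Prop :=
  ∀ φ : EuclideanSpace ℝ (Fin n) → ℝ, LocallyLipschitz φ → HasCompactSupport φ → tsupport φ ⊆ V →
    ∫ x, energyForm a N x (fderiv ℝ f x) (fderiv ℝ φ x) = -∫ x, g x * φ x

variable {a : ℝ → Matrix (Fin n) (Fin n) ℝ} {N : Fin n} {δ Λ : ℝ}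
  {V W : Set (EuclideanSpace ℝ (Fin n))} {f f₁ f₂ g g₁ g₂ : EuclideanSpace ℝ (Fin n) → ℝ}

theorem WeakEq.mono (h : WeakEq a N V f g) (hWV : W ⊆ V) : WeakEq a N W f g :=
  fun φ h1 h2 h3 => h φ h1 h2 (h3.trans hWV)

theorem WeakEq.congr_right (h : WeakEq a N V f g₁) (hg : ∀ x, g₁ x = g₂ x) :
    WeakEq a N V f g₂ := by
  rwa [← funext hg]

theorem weakEq_const (c : ℝ) : WeakEq a N V (fun _ => c) fun _ => 0 := by
  intro φ _ _ _
  simp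

theorem EllipticCoeff.integrable_energyForm (ha : EllipticCoeff δ Λ a) (hf : LocallyLipschitz f)
    {φ : EuclideanSpace ℝ (Fin n) → ℝ} (hφ : LocallyLipschitz φ) (hc : HasCompactSupport φ) :
    Integrable fun x => energyForm a N x (fderiv ℝ f x) (fderiv ℝ φ x) :=
  (ha.isLocBounded_energyForm hf hφ).integrable hc fun x hx => by
    rw [fderiv_of_notMem_tsupport (𝕜 := ℝ) hx]
    simp

theorem IsLocBounded.integrable_mul (hg : IsLocBounded g)
    {φ : EuclideanSpace ℝ (Fin n) → ℝ} (hφ : Continuous φ) (hc : HasCompactSupport φ) :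
    Integrable fun x => g x * φ x :=
  (hg.mul (.of_continuous hφ)).integrable hc fun x hx => by
    rw [image_eq_zero_of_notMem_tsupport hx, mul_zero]

theorem WeakEq.const_mul (h : WeakEq a N V f g) (c : ℝ) (hf : LocallyLipschitz f) :
    WeakEq a N V (fun x => c * f x) (fun x => c * g x) := by
  intro φ h1 h2 h3
  have : ∀ᵐ x, energyForm a N x (fderiv ℝ (fun x => c * f x) x) (fderiv ℝ φ x) =
      c * energyForm a N x (fderiv ℝ f x) (fderiv ℝ φ x) := by
    filter_upwards [hf.ae_differentiableAt] with x hx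
    rw [fderiv_const_mul hx, map_smul]
    rfl
  rw [integral_congr_ae this, integral_const_mul, h φ h1 h2 h3]
  simp_rw [mul_assoc]
  rw [integral_const_mul, mul_neg]

theorem WeakEq.add (ha : EllipticCoeff δ Λ a) (h₁ : WeakEq a N V f₁ g₁) (h₂ : WeakEq a N V f₂ g₂)
    (hf₁ : LocallyLipschitz f₁) (hf₂ : LocallyLipschitz f₂) (hg₁ : IsLocBounded g₁)
    (hg₂ : IsLocBounded g₂) : WeakEq a N V (fun x => f₁ x + f₂ x) (fun x => g₁ x + g₂ x) := by
  intro φ h1 h2 h3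
  have : ∀ᵐ x, energyForm a N x (fderiv ℝ (fun x => f₁ x + f₂ x) x) (fderiv ℝ φ x) =
      energyForm a N x (fderiv ℝ f₁ x) (fderiv ℝ φ x) +
      energyForm a N x (fderiv ℝ f₂ x) (fderiv ℝ φ x) := by
    filter_upwards [hf₁.ae_differentiableAt, hf₂.ae_differentiableAt] with x hx hx'
    rw [fderiv_fun_add hx hx', map_add]
    rfl
  rw [integral_congr_ae this, integral_add (ha.integrable_energyForm hf₁ h1 h2)
    (ha.integrable_energyForm hf₂ h1 h2), h₁ φ h1 h2 h3, h₂ φ h1 h2 h3]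
  simp_rw [add_mul]
  rw [integral_add (hg₁.integrable_mul h1.continuous h2) (hg₂.integrable_mul h1.continuous h2)]
  ring

theorem WeakEq.finset_sum (ha : EllipticCoeff δ Λ a) {ι : Type*} (s : Finset ι)
    {F G : ι → EuclideanSpace ℝ (Fin n) → ℝ} (h : ∀ i ∈ s, WeakEq a N V (F i) (G i))
    (hF : ∀ i ∈ s, LocallyLipschitz (F i)) (hG : ∀ i ∈ s, IsLocBounded (G i)) :
    WeakEq a N V (fun x => ∑ i ∈ s, F i x) (fun x => ∑ i ∈ s, G i x) := by
  classical
  induction s using Finset.induction_on with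
  | empty => simpa using weakEq_const (a := a) (N := N) (V := V) 0
  | insert i s hi ih =>
    simp only [Finset.sum_insert hi]
    exact (h i (by simp)).add ha (ih (fun j hj => h j (by simp [hj])) (fun j hj => hF j (by simp [hj]))
      fun j hj => hG j (by simp [hj])) (hF i (by simp))
      (.finset_sum s fun j hj => hF j (by simp [hj])) (hG i (by simp))
      (.finset_sum s fun j hj => hG j (by simp [hj]))

theorem WeakEq.mul (ha : EllipticCoeff δ Λ a) (h₁ : WeakEq a N V f₁ g₁) (h₂ : WeakEq a N V f₂ g₂)
    (hf₁ : LocallyLipschitz f₁) (hf₂ : LocallyLipschitz f₂) (hg₁ : IsLocBounded g₁)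
    (hg₂ : IsLocBounded g₂) : WeakEq a N V (fun x => f₁ x * f₂ x) (fun x => f₁ x * g₂ x + f₂ x * g₁ x
      + 2 * energyForm a N x (fderiv ℝ f₁ x) (fderiv ℝ f₂ x)) := by
  intro φ h1 h2 h3
  have hE := ha.isLocBounded_energyForm (N := N) hf₁ hf₂
  have hc₁ : HasCompactSupport fun x => f₁ x * φ x := h2.mul_left
  have hc₂ : HasCompactSupport fun x => f₂ x * φ x := h2.mul_left
  have hl₁ := hf₁.real_mul h1
  have hl₂ := hf₂.real_mul h1
  have hs₁ : tsupport (fun x => f₁ x * φ x) ⊆ V := (tsupport_mul_subset_right).trans h3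
  have hs₂ : tsupport (fun x => f₂ x * φ x) ⊆ V := (tsupport_mul_subset_right).trans h3
  have : ∀ᵐ x, energyForm a N x (fderiv ℝ (fun x => f₁ x * f₂ x) x) (fderiv ℝ φ x) =
      energyForm a N x (fderiv ℝ f₂ x) (fderiv ℝ (fun x => f₁ x * φ x) x) +
      energyForm a N x (fderiv ℝ f₁ x) (fderiv ℝ (fun x => f₂ x * φ x) x) -
      2 * energyForm a N x (fderiv ℝ f₁ x) (fderiv ℝ f₂ x) * φ x := by
    filter_upwards [hf₁.ae_differentiableAt, hf₂.ae_differentiableAt, h1.ae_differentiableAt]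
      with x hx₁ hx₂ hφ
    rw [fderiv_fun_mul hx₁ hx₂, fderiv_fun_mul hx₁ hφ, fderiv_fun_mul hx₂ hφ]
    simp only [map_add, map_smul, LinearMap.add_apply, LinearMap.smul_apply, smul_eq_mul]
    rw [ha.energyForm_comm x (fderiv ℝ f₂ x) (fderiv ℝ f₁ x)]
    ring
  rw [integral_congr_ae this, integral_sub, integral_add, h₁ _ hl₂ hc₂ hs₂, h₂ _ hl₁ hc₁ hs₁]
  · have e : ∀ x, (f₁ x * g₂ x + f₂ x * g₁ x +
        2 * energyForm a N x (fderiv ℝ f₁ x) (fderiv ℝ f₂ x)) * φ x =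
        g₂ x * (f₁ x * φ x) + g₁ x * (f₂ x * φ x) +
        2 * energyForm a N x (fderiv ℝ f₁ x) (fderiv ℝ f₂ x) * φ x := fun x => by ring
    simp_rw [e]
    rw [integral_add, integral_add]
    · ring
    · exact hg₂.integrable_mul hl₁.continuous hc₁
    · exact hg₁.integrable_mul hl₂.continuous hc₂
    · exact (hg₂.integrable_mul hl₁.continuous hc₁).add (hg₁.integrable_mul hl₂.continuous hc₂)
    · exact (hE.const_mul 2).integrable_mul h1.continuous h2
  · exact ha.integrable_energyForm hf₂ hl₁ hc₁
  · exact ha.integrable_energyForm hf₁ hl₂ hc₂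
  · exact (ha.integrable_energyForm hf₂ hl₁ hc₁).add (ha.integrable_energyForm hf₁ hl₂ hc₂)
  · exact (hE.const_mul 2).integrable_mul h1.continuous h2

theorem hasDerivAt_max_zero_sq (t : ℝ) :
    HasDerivAt (fun s : ℝ => max s 0 ^ 2) (2 * max t 0) t := by
  rcases lt_trichotomy t 0 with ht | rfl | ht
  · have h : (fun s : ℝ => max s 0 ^ 2) =ᶠ[nhds t] fun _ => 0 := by
      filter_upwards [Iio_mem_nhds ht] with s hs
      rw [max_eq_right (le_of_lt hs), zero_pow two_ne_zero]
    rw [max_eq_right ht.le, mul_zero]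
    exact (hasDerivAt_const t (0 : ℝ)).congr_of_eventuallyEq h
  · have h : (fun s : ℝ => max s 0 ^ 2) =O[nhds 0] fun s => s ^ 2 := by
      refine Asymptotics.isBigO_of_le _ fun s => ?_
      rw [Real.norm_of_nonneg (sq_nonneg _), Real.norm_of_nonneg (sq_nonneg _)]
      rcases le_total s 0 with hs | hs
      · rw [max_eq_right hs]
        simpa using sq_nonneg s
      · rw [max_eq_left hs]
    rw [max_self, mul_zero, hasDerivAt_iff_isLittleO_nhds_zero]
    simpa using h.trans_isLittleO (Asymptotics.isLittleO_pow_id one_lt_two)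
  · have h : (fun s : ℝ => max s 0 ^ 2) =ᶠ[nhds t] fun s => s ^ 2 := by
      filter_upwards [Ioi_mem_nhds ht] with s hs
      rw [max_eq_left (le_of_lt hs)]
    rw [max_eq_left ht.le]
    simpa using (hasDerivAt_pow 2 t).congr_of_eventuallyEq h

theorem LocallyLipschitz.of_eventuallyEq {φ : EuclideanSpace ℝ (Fin n) → ℝ}
    (h : ∀ x, ∃ θ : EuclideanSpace ℝ (Fin n) → ℝ, LocallyLipschitz θ ∧ φ =ᶠ[nhds x] θ) :
    LocallyLipschitz φ := by
  intro x
  obtain ⟨θ, hθ, he⟩ := h x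
  obtain ⟨K, t, ht, hK⟩ := hθ x
  refine ⟨K, t ∩ {y | φ y = θ y}, Filter.inter_mem ht he, fun y hy z hz => ?_⟩
  rw [hy.2, hz.2]
  exact hK hy.1 hz.1

/-- Weak maximum principle for Lipschitz subsolutions, in the presence of a strict subsolution. -/
theorem WeakEq.nonpos_of_frontier (ha : EllipticCoeff δ Λ a)
    {v q G : EuclideanSpace ℝ (Fin n) → ℝ} {Ω : Set (EuclideanSpace ℝ (Fin n))}
    (hv : WeakEq a N V v g) (hvl : LocallyLipschitz v)
    (hq : WeakEq a N V q G)
    (hGl : IsLocBounded G) (hΩ : IsOpen Ω) (hc : IsCompact (closure Ω)) (hΩV : closure Ω ⊆ V)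
    (hg : ∀ᵐ x, x ∈ Ω → 0 ≤ g x) (hG : ∀ᵐ x, x ∈ Ω → 0 < G x)
    (hb : ∀ x ∈ frontier Ω, v x ≤ 0) : ∀ x ∈ Ω, v x ≤ 0 := by
  intro x₀ hx₀
  refine le_of_forall_pos_le_add fun ε hε => ?_
  set θ : EuclideanSpace ℝ (Fin n) → ℝ := fun x => max (v x - ε) 0 ^ 2 with hθ
  set ψ : EuclideanSpace ℝ (Fin n) → ℝ := Ω.indicator θ with hψ
  have hθl : LocallyLipschitz θ := by
    have h1 : LocallyLipschitz fun x => max (v x - ε) 0 :=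
      (hvl.sub (LocallyLipschitz.const ε)).max_const 0
    simpa only [hθ, sq] using h1.real_mul h1
  have hin : ∀ x ∈ Ω, ψ =ᶠ[nhds x] θ := fun x hx => by
    filter_upwards [hΩ.mem_nhds hx] with y hy using indicator_of_mem hy _
  have hout : ∀ x, x ∉ Ω → ψ =ᶠ[nhds x] fun _ => 0 := by
    intro x hx
    by_cases hx' : x ∈ closure Ω
    · have hf : x ∈ frontier Ω := by
        rw [hΩ.frontier_eq]
        exact ⟨hx', hx⟩
      have : v x < ε := (hb x hf).trans_lt hε
      filter_upwards [hvl.continuous.continuousAt.eventually_lt continuousAt_const this] with y hy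
      by_cases hyΩ : y ∈ Ω
      · rw [hψ, indicator_of_mem hyΩ, hθ]
        simp only
        rw [max_eq_right (by linarith), zero_pow two_ne_zero]
      · rw [hψ, indicator_of_notMem hyΩ]
    · filter_upwards [isClosed_closure.isOpen_compl.mem_nhds hx'] with y hy
      exact indicator_of_notMem (fun h => hy (subset_closure h)) _
  have hψl : LocallyLipschitz ψ := .of_eventuallyEq fun x => by
    by_cases hx : x ∈ Ω
    · exact ⟨θ, hθl, hin x hx⟩
    · exact ⟨_, LocallyLipschitz.const 0, hout x hx⟩
  have hts : tsupport ψ ⊆ closure Ω :=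
    closure_mono (Set.support_indicator_subset)
  have hψc : HasCompactSupport ψ := hc.of_isClosed_subset (isClosed_tsupport _) hts
  have hψ0 : ∀ x, 0 ≤ ψ x := fun x => indicator_nonneg (fun _ _ => sq_nonneg _) x
  have hd : ∀ᵐ x, (x ∈ Ω → fderiv ℝ ψ x = (2 * max (v x - ε) 0) • fderiv ℝ v x) ∧
      (x ∉ Ω → fderiv ℝ ψ x = 0) := by
    filter_upwards [hvl.ae_differentiableAt] with x hx
    refine ⟨fun h => ?_, fun h => ?_⟩
    · rw [(hin x h).fderiv_eq]
      exact ((hasDerivAt_max_zero_sq (v x - ε)).comp_hasFDerivAt x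
        (hx.hasFDerivAt.sub_const ε)).fderiv
    · rw [(hout x h).fderiv_eq]
      simp
  have hI := hv ψ hψl hψc (hts.trans hΩV)
  have hnn : 0 ≤ᵐ[volume] fun x => energyForm a N x (fderiv ℝ v x) (fderiv ℝ ψ x) := by
    filter_upwards [hd] with x hx
    by_cases h : x ∈ Ω
    · simp only [hx.1 h, map_smul, Pi.zero_apply, smul_eq_mul]
      exact mul_nonneg (by positivity) (ha.energyForm_nonneg x _)
    · simp [hx.2 h]
  have hgψ : 0 ≤ ∫ x, g x * ψ x := integral_nonneg_of_ae <| by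
    filter_upwards [hg] with x hx
    by_cases h : x ∈ Ω
    · exact mul_nonneg (hx h) (hψ0 x)
    · simp [hψ, h]
  have hz := (integral_eq_zero_iff_of_nonneg_ae hnn (ha.integrable_energyForm hvl hψl hψc)).1
    (le_antisymm (by rw [hI]; linarith) (integral_nonneg_of_ae hnn))
  have hd0 : ∀ᵐ x, fderiv ℝ ψ x = 0 := by
    filter_upwards [hz, hd] with x hx hx'
    by_cases h : x ∈ Ω
    · rw [hx'.1 h]
      simp only [hx'.1 h, map_smul, Pi.zero_apply, smul_eq_mul, mul_eq_zero] at hx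
      rcases hx with hx | hx
      · have : max (v x - ε) 0 = 0 := by linarith [hx.resolve_left two_ne_zero]
        simp [this]
      · have h1 := ha.mul_norm_sq_le_energyForm (N := N) x (fderiv ℝ v x)
        rw [hx] at h1
        have h2 : ‖fderiv ℝ v x‖ ^ 2 ≤ 0 := by
          by_contra! h3
          exact absurd h1 (not_le.2 (mul_pos ha.delta_pos h3))
        have h3 : ‖fderiv ℝ v x‖ = 0 := by nlinarith [norm_nonneg (fderiv ℝ v x)]
        rw [norm_eq_zero.1 h3, smul_zero]
    · exact hx'.2 h
  have hJ := hq ψ hψl hψc (hts.trans hΩV)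
  have hJ0 : ∫ x, energyForm a N x (fderiv ℝ q x) (fderiv ℝ ψ x) = 0 := by
    rw [← integral_zero (EuclideanSpace ℝ (Fin n)) ℝ]
    refine integral_congr_ae ?_
    filter_upwards [hd0] with x hx
    simp [hx]
  have hGnn : 0 ≤ᵐ[volume] fun x => G x * ψ x := by
    filter_upwards [hG] with x hx
    by_cases h : x ∈ Ω
    · exact mul_nonneg (hx h).le (hψ0 x)
    · simp [hψ, h]
  have hGz := (integral_eq_zero_iff_of_nonneg_ae hGnn
    (hGl.integrable_mul hψl.continuous hψc)).1 (by linarith)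
  have hψz : ψ =ᵐ[volume] fun _ => 0 := by
    filter_upwards [hGz, hG] with x hx hx'
    by_cases h : x ∈ Ω
    · exact (mul_eq_zero.1 hx).resolve_left (hx' h).ne'
    · simp [hψ, h]
  have hψe : ψ = fun _ => 0 := (Continuous.ae_eq_iff_eq volume hψl.continuous continuous_const).1 hψz
  have h0 : θ x₀ = 0 := by
    rw [← indicator_of_mem hx₀ θ, ← hψ, hψe]
  have h1 : max (v x₀ - ε) 0 = 0 := by simpa [hθ] using h0
  have := le_max_left (v x₀ - ε) 0
  linarith

end WeakEquation

section Mollification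

open Filter Topology ContinuousLinearMap Convolution
open scoped ContDiff

variable {E : Type*} [NormedAddCommGroup E] [InnerProductSpace ℝ E] [FiniteDimensional ℝ E]
  [MeasurableSpace E] [BorelSpace E]

theorem LipschitzWith.hasFDerivAt_convolution_left {b φ : E → ℝ} {K : NNReal} (hb : Continuous b)
    (hbc : HasCompactSupport b) (hφ : LipschitzWith K φ) (x : E) :
    HasFDerivAt (b ⋆[lsmul ℝ ℝ, volume] φ) (∫ t, b t • fderiv ℝ φ (x - t)) x := by
  have hint : Integrable b := hb.integrable_of_hasCompactSupport hbc
  have key := hasFDerivAt_integral_of_dominated_loc_of_lip (μ := (volume : Measure E)) (𝕜 := ℝ)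
    (F := fun x t => b t * φ (x - t)) (F' := fun t => b t • fderiv ℝ φ (x - t))
    (x₀ := x) (bound := fun t => K * |b t|) (s := univ) univ_mem
    (Eventually.of_forall fun y => ?_) ?_ ?_ ?_ ?_ ?_
  · exact key.2
  · exact (hb.mul (hφ.continuous.comp (by fun_prop))).aestronglyMeasurable
  · exact (hb.mul (hφ.continuous.comp (by fun_prop))).integrable_of_hasCompactSupport
      hbc.mul_right
  · refine (Measurable.smul hb.measurable ?_).aestronglyMeasurable
    exact (measurable_fderiv ℝ φ).comp (by fun_prop)
  · refine Eventually.of_forall fun t => LipschitzWith.lipschitzOnWith ?_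
    refine LipschitzWith.of_dist_le_mul fun y z => ?_
    have := hφ.dist_le_mul (y - t) (z - t)
    rw [dist_sub_right] at this
    rw [Real.dist_eq] at this ⊢
    rw [← mul_sub, abs_mul]
    simp only [Real.coe_nnabs, abs_mul, abs_abs, NNReal.abs_eq]
    nlinarith [abs_nonneg (b t)]
  · exact (hint.abs).const_mul _
  · have := (quasiMeasurePreserving_sub_left_of_right_invariant volume x).ae hφ.ae_differentiableAt
    filter_upwards [this] with t ht
    have h1 : HasFDerivAt (fun y => φ (y - t)) (fderiv ℝ φ (x - t)) x :=
      (hasFDerivAt_comp_sub t).2 ht.hasFDerivAt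
    simpa using h1.const_mul (b t)

theorem exists_smooth_approx {φ : E → ℝ} {V : Set E} (hφ : LocallyLipschitz φ)
    (hc : HasCompactSupport φ) (hV : IsOpen V) (hs : tsupport φ ⊆ V) :
    ∃ (Φ : ℕ → E → ℝ) (C : ℝ) (s : Set E), IsCompact s ∧ s ⊆ V ∧
      (∀ k, ContDiff ℝ ∞ (Φ k)) ∧ (∀ k, tsupport (Φ k) ⊆ s) ∧ (∀ k x, ‖fderiv ℝ (Φ k) x‖ ≤ C) ∧
      ∀ v, ∀ᵐ x, Tendsto (fun k => fderiv ℝ (Φ k) x v) atTop (𝓝 (fderiv ℝ φ x v)) := by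
  obtain ⟨K, hK⟩ := hφ.exists_lipschitzWith_of_hasCompactSupport hc
  obtain ⟨r, hr, hrV⟩ := IsCompact.exists_cthickening_subset_open hc hV hs
  let b : ℕ → ContDiffBump (0 : E) := fun k =>
    ⟨r / (k + 1) / 2, r / (k + 1), by positivity, half_lt_self (by positivity)⟩
  have hb : ∀ k, Continuous ((b k).normed volume) := fun k => (b k).continuous_normed
  have hD : ∀ k x, HasFDerivAt ((b k).normed volume ⋆[lsmul ℝ ℝ, volume] φ)
      (∫ t, (b k).normed volume t • fderiv ℝ φ (x - t)) x := fun k x =>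
    hK.hasFDerivAt_convolution_left (hb k) (b k).hasCompactSupport_normed x
  have hint : ∀ k x, Integrable fun t => (b k).normed volume t • fderiv ℝ φ (x - t) := by
    intro k x
    refine Integrable.mono' (((b k).integrable_normed (μ := volume)).const_mul (K : ℝ)) ?_ ?_
    · exact (Measurable.smul (hb k).measurable
        ((measurable_fderiv ℝ φ).comp (by fun_prop))).aestronglyMeasurable
    · refine Eventually.of_forall fun t => ?_
      rw [norm_smul, Real.norm_of_nonneg ((b k).nonneg_normed t), mul_comm]
      exact mul_le_mul_of_nonneg_right (norm_fderiv_le_of_lipschitz ℝ hK) ((b k).nonneg_normed t)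
  refine ⟨fun k => (b k).normed volume ⋆[lsmul ℝ ℝ, volume] φ, K, cthickening r (tsupport φ),
    IsCompact.cthickening hc, hrV, fun k => ?_, fun k => ?_, fun k x => ?_, fun v => ?_⟩
  · exact (b k).hasCompactSupport_normed.contDiff_convolution_left _ (b k).contDiff_normed
      hφ.continuous.locallyIntegrable
  · refine closure_minimal ?_ isClosed_cthickening
    refine (support_convolution_subset _).trans ?_
    rw [ContDiffBump.support_normed_eq]
    rintro _ ⟨z, hz, y, hy, rfl⟩
    rw [mem_ball_zero_iff] at hz
    refine mem_cthickening_of_dist_le (z + y) y r _ (subset_closure hy) ?_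
    rw [dist_eq_norm, add_sub_cancel_right]
    refine hz.le.trans ?_
    exact div_le_self hr.le (by simp)
  · rw [(hD k x).fderiv]
    refine (norm_integral_le_of_norm_le
      (((b k).integrable_normed (μ := volume)).const_mul (K : ℝ)) ?_).trans ?_
    · refine Eventually.of_forall fun t => ?_
      rw [norm_smul, Real.norm_of_nonneg ((b k).nonneg_normed t), mul_comm]
      exact mul_le_mul_of_nonneg_right (norm_fderiv_le_of_lipschitz ℝ hK) ((b k).nonneg_normed t)
    · rw [integral_const_mul, (b k).integral_normed, mul_one]
  · have hloc : LocallyIntegrable (fun x => fderiv ℝ φ x v) := by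
      refine LocallyIntegrable.mono (g := fun x => fderiv ℝ φ x v)
        (f := fun _ : E => (K : ℝ) * ‖v‖) (locallyIntegrable_const _)
        (measurable_fderiv_apply_const ℝ φ v).aestronglyMeasurable
        (Eventually.of_forall fun x => ?_)
      exact ((fderiv ℝ φ x).le_of_opNorm_le (norm_fderiv_le_of_lipschitz ℝ hK) v).trans
        (le_abs_self _)
    have := ContDiffBump.ae_convolution_tendsto_right_of_locallyIntegrable (φ := b) (l := atTop)
      (K := 2) (μ := volume) ?_ ?_ hloc
    · filter_upwards [this] with x hx
      refine hx.congr fun k => ?_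
      rw [(hD k x).fderiv, ContinuousLinearMap.integral_apply (hint k x)]
      rfl
    · have := (tendsto_one_div_add_atTop_nhds_zero_nat (𝕜 := ℝ)).const_mul r
      simpa [b, div_eq_mul_inv] using this
    · refine Eventually.of_forall fun k => ?_
      simp only [b]
      linarith

end Mollification

section Density

open Filter Topology
open scoped ContDiff

variable {n : ℕ} {a : ℝ → Matrix (Fin n) (Fin n) ℝ} {N : Fin n} {δ Λ : ℝ}
  {V : Set (EuclideanSpace ℝ (Fin n))} {f : EuclideanSpace ℝ (Fin n) → ℝ}

theorem WeakEq.of_smooth (ha : EllipticCoeff δ Λ a) (hV : IsOpen V) (hf : LocallyLipschitz f)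
    (h : ∀ φ : EuclideanSpace ℝ (Fin n) → ℝ, ContDiff ℝ ∞ φ → HasCompactSupport φ →
      tsupport φ ⊆ V → ∫ x, energyForm a N x (fderiv ℝ f x) (fderiv ℝ φ x) = 0) :
    WeakEq a N V f fun _ => 0 := by
  intro φ hφ hc hs
  obtain ⟨Φ, C, s, hsc, hsV, hΦ, hΦs, hΦC, hlim⟩ := exists_smooth_approx hφ hc hV hs
  obtain ⟨D, hD0, hD⟩ := hf.exists_norm_fderiv_le hsc
  have hΦc : ∀ k, HasCompactSupport (Φ k) := fun k =>
    hsc.of_isClosed_subset (isClosed_tsupport _) (hΦs k)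
  have ht : Tendsto (fun k => ∫ x, energyForm a N x (fderiv ℝ f x) (fderiv ℝ (Φ k) x)) atTop
      (𝓝 (∫ x, energyForm a N x (fderiv ℝ f x) (fderiv ℝ φ x))) := by
    refine tendsto_integral_of_dominated_convergence
      (s.indicator fun _ => n ^ 2 * Λ * D * C) (fun k => ?_) ?_ (fun k => ?_) ?_
    · exact (ha.measurable_energyForm measurable_id (measurable_fderiv ℝ f)
        (measurable_fderiv ℝ (Φ k))).aestronglyMeasurable
    · rw [integrable_indicator_iff hsc.measurableSet]
      exact integrableOn_const hsc.measure_lt_top.ne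
    · refine Eventually.of_forall fun x => ?_
      by_cases hx : x ∈ s
      · rw [indicator_of_mem hx]
        refine (ha.abs_energyForm_le x _ _).trans ?_
        have := ha.bound_nonneg N
        gcongr
        exacts [hD x hx, hΦC k x]
      · rw [fderiv_of_notMem_tsupport (𝕜 := ℝ) fun h => hx (hΦs k h)]
        simp [hx]
    · have : ∀ᵐ x, ∀ i, Tendsto (fun k => fderiv ℝ (Φ k) x (EuclideanSpace.single i 1)) atTop
          (𝓝 (fderiv ℝ φ x (EuclideanSpace.single i 1))) :=
        ae_all_iff.2 fun i => hlim _
      filter_upwards [this] with x hx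
      simp only [energyForm_apply]
      exact tendsto_finsetSum _ fun i _ => tendsto_finsetSum _ fun j _ => (hx i).const_mul _
  have h0 : ∀ k, ∫ x, energyForm a N x (fderiv ℝ f x) (fderiv ℝ (Φ k) x) = 0 := fun k =>
    h _ (hΦ k) (hΦc k) ((hΦs k).trans hsV)
  simp only [h0] at ht
  simpa using tendsto_nhds_unique ht tendsto_const_nhds

end Density

section HarmonicCoordinates

open Filter Topology
open scoped ContDiff

variable {n : ℕ} {a : ℝ → Matrix (Fin n) (Fin n) ℝ} {N : Fin n} {δ Λ : ℝ}

theorem EllipticCoeff.le_diag (ha : EllipticCoeff δ Λ a) (s : ℝ) (i : Fin n) : δ ≤ a s i i := by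
  have := ha.elliptic s (Pi.single i 1)
  simpa [Pi.single_apply] using this

theorem EllipticCoeff.diag_pos (ha : EllipticCoeff δ Λ a) (s : ℝ) (i : Fin n) : 0 < a s i i :=
  ha.delta_pos.trans_le (ha.le_diag s i)

theorem EllipticCoeff.diag_le (ha : EllipticCoeff δ Λ a) (s : ℝ) (i : Fin n) : a s i i ≤ Λ :=
  (le_abs_self _).trans (ha.bound s i i)

theorem EllipticCoeff.bound_pos (ha : EllipticCoeff δ Λ a) (i : Fin n) : 0 < Λ :=
  (ha.diag_pos 0 i).trans_le (ha.diag_le 0 i)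

/-- The derivative in the last variable of the harmonic coordinate `harmonicCoord a N x₀ k`. -/
noncomputable def harmonicSlope (a : ℝ → Matrix (Fin n) (Fin n) ℝ) (N k : Fin n) (t : ℝ) : ℝ :=
  if k = N then (a t N N)⁻¹ else -(a t N k / a t N N)

/-- Coordinates centred at `x₀` solving `div (a(xᴺ) ∇h) = 0`. -/
noncomputable def harmonicCoord (a : ℝ → Matrix (Fin n) (Fin n) ℝ) (N : Fin n)
    (x₀ : EuclideanSpace ℝ (Fin n)) (k : Fin n) (x : EuclideanSpace ℝ (Fin n)) : ℝ :=
  (if k = N then 0 else x k - x₀ k) + ∫ t in x₀ N..x N, harmonicSlope a N k t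

theorem EllipticCoeff.measurable_harmonicSlope (ha : EllipticCoeff δ Λ a) (k : Fin n) :
    Measurable (harmonicSlope a N k) := by
  unfold harmonicSlope
  split_ifs
  · exact (ha.measurable N N).inv
  · exact ((ha.measurable N k).div (ha.measurable N N)).neg

theorem EllipticCoeff.abs_harmonicSlope_le (ha : EllipticCoeff δ Λ a) (k : Fin n) (t : ℝ) :
    |harmonicSlope a N k t| ≤ (1 + Λ) / δ := by
  have h1 := ha.delta_pos
  have h2 := ha.diag_pos t N
  have h3 := ha.bound_pos N
  have h4 := ha.le_diag t N
  unfold harmonicSlope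
  split_ifs
  · rw [abs_inv, abs_of_pos h2, ← one_div]
    exact div_le_div₀ (by linarith) (by linarith) h1 h4
  · rw [abs_neg, abs_div, abs_of_pos h2]
    exact div_le_div₀ (by linarith) ((ha.bound t N k).trans (by linarith)) h1 h4

theorem EllipticCoeff.locallyIntegrable_harmonicSlope (ha : EllipticCoeff δ Λ a) (k : Fin n) :
    LocallyIntegrable (harmonicSlope a N k) :=
  (locallyIntegrable_const ((1 + Λ) / δ)).mono (ha.measurable_harmonicSlope k).aestronglyMeasurable
    (Eventually.of_forall fun t => (ha.abs_harmonicSlope_le k t).trans (le_abs_self _))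

theorem EllipticCoeff.intervalIntegrable_harmonicSlope (ha : EllipticCoeff δ Λ a) (k : Fin n)
    (s t : ℝ) : IntervalIntegrable (harmonicSlope a N k) volume s t :=
  ((ha.locallyIntegrable_harmonicSlope k).integrableOn_isCompact isCompact_uIcc).intervalIntegrable

theorem EllipticCoeff.abs_integral_harmonicSlope_le (ha : EllipticCoeff δ Λ a) (k : Fin n)
    (s t : ℝ) : |∫ r in s..t, harmonicSlope a N k r| ≤ (1 + Λ) / δ * |t - s| := by
  rw [← Real.norm_eq_abs]
  exact intervalIntegral.norm_integral_le_of_norm_le_const fun r _ => ha.abs_harmonicSlope_le k r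

theorem abs_coord_sub_le (x y : EuclideanSpace ℝ (Fin n)) (i : Fin n) : |x i - y i| ≤ dist x y := by
  rw [dist_eq_norm]
  simpa using PiLp.norm_apply_le (x - y) i

theorem EllipticCoeff.lipschitzWith_harmonicCoord (ha : EllipticCoeff δ Λ a)
    (x₀ : EuclideanSpace ℝ (Fin n)) (k : Fin n) :
    LipschitzWith (Real.toNNReal (1 + (1 + Λ) / δ)) (harmonicCoord a N x₀ k) := by
  have h1 := ha.delta_pos
  have h3 := ha.bound_pos N
  refine LipschitzWith.of_dist_le_mul fun x y => ?_
  rw [Real.coe_toNNReal _ (by positivity), Real.dist_eq]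
  have hI : harmonicCoord a N x₀ k x - harmonicCoord a N x₀ k y =
      (if k = N then 0 else x k - y k) + ∫ t in y N..x N, harmonicSlope a N k t := by
    rw [← intervalIntegral.integral_interval_sub_left
      (ha.intervalIntegrable_harmonicSlope k (x₀ N) (x N))
      (ha.intervalIntegrable_harmonicSlope k (x₀ N) (y N))]
    unfold harmonicCoord
    split_ifs <;> ring
  have h4 : |∫ t in y N..x N, harmonicSlope a N k t| ≤ (1 + Λ) / δ * dist x y := by
    refine (ha.abs_integral_harmonicSlope_le k _ _).trans ?_
    gcongr
    exact abs_coord_sub_le x y N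
  have h5 : |if k = N then 0 else x k - y k| ≤ dist x y := by
    split_ifs
    · simp
    · exact abs_coord_sub_le x y k
  rw [hI]
  refine (abs_add_le _ _).trans ?_
  linarith

theorem ae_apply_coord {P : ℝ → Prop} (h : ∀ᵐ t, P t) (N : Fin n) :
    ∀ᵐ x : EuclideanSpace ℝ (Fin n), P (x N) :=
  ((Measure.quasiMeasurePreserving_eval (fun _ : Fin n => (volume : Measure ℝ)) N).comp
    (PiLp.volume_preserving_ofLp (Fin n)).quasiMeasurePreserving).ae h

theorem EllipticCoeff.ae_hasFDerivAt_harmonicCoord (ha : EllipticCoeff δ Λ a)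
    (x₀ : EuclideanSpace ℝ (Fin n)) (k : Fin n) :
    ∀ᵐ x, HasFDerivAt (harmonicCoord a N x₀ k)
      ((if k = N then 0 else EuclideanSpace.proj k) +
        harmonicSlope a N k (x N) • (EuclideanSpace.proj N : EuclideanSpace ℝ (Fin n) →L[ℝ] ℝ))
      x := by
  filter_upwards [ae_apply_coord
    (LocallyIntegrable.ae_hasDerivAt_integral (ha.locallyIntegrable_harmonicSlope k)) N] with x hx
  have h1 : HasFDerivAt (fun y : EuclideanSpace ℝ (Fin n) => ∫ t in x₀ N..y N, harmonicSlope a N k t)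
      (harmonicSlope a N k (x N) • (EuclideanSpace.proj N : EuclideanSpace ℝ (Fin n) →L[ℝ] ℝ)) x :=
    HasDerivAt.comp_hasFDerivAt (f := fun y : EuclideanSpace ℝ (Fin n) => y N) x (hx (x₀ N))
      (EuclideanSpace.proj N : EuclideanSpace ℝ (Fin n) →L[ℝ] ℝ).hasFDerivAt
  refine HasFDerivAt.add ?_ h1
  split_ifs
  · exact hasFDerivAt_const _ _
  · exact (EuclideanSpace.proj k : EuclideanSpace ℝ (Fin n) →L[ℝ] ℝ).hasFDerivAt.sub_const _

/-- The flux of a harmonic coordinate. -/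
theorem EllipticCoeff.ae_energyForm_harmonicCoord (ha : EllipticCoeff δ Λ a)
    (x₀ : EuclideanSpace ℝ (Fin n)) (k : Fin n) :
    ∀ᵐ x, ∀ M, energyForm a N x (fderiv ℝ (harmonicCoord a N x₀ k) x) M =
      ∑ i, ((if k = N then 0 else a (x N) i k) + a (x N) i N * harmonicSlope a N k (x N)) *
        M (EuclideanSpace.single i 1) := by
  filter_upwards [ha.ae_hasFDerivAt_harmonicCoord (N := N) x₀ k] with x hx M
  rw [hx.fderiv, energyForm_apply]
  refine Finset.sum_congr rfl fun i _ => ?_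
  rw [← Finset.sum_mul]
  congr 1
  split_ifs <;> simp [mul_add, Finset.sum_add_distrib]

theorem integral_mul_fderiv_eq_zero {F φ : EuclideanSpace ℝ (Fin n) → ℝ}
    {e : EuclideanSpace ℝ (Fin n)} (hF : IsLocBounded F) (he : ∀ x (t : ℝ), F (x + t • e) = F x)
    (hφ : ContDiff ℝ ∞ φ) (hc : HasCompactSupport φ) : ∫ x, F x * fderiv ℝ φ x e = 0 := by
  have h0 := integral_bilinear_hasLineDerivAt_right_eq_neg_left_of_integrable
    (μ := (volume : Measure (EuclideanSpace ℝ (Fin n)))) (f := F) (f' := fun _ => 0) (g := φ)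
    (g' := fun x => fderiv ℝ φ x e) (v := e) (B := ContinuousLinearMap.mul ℝ ℝ)
    (by simp) ?_ ?_ (fun x _ => ?_) (fun x _ => ?_)
  · simpa using h0
  · refine IsLocBounded.integrable (s := tsupport φ) (hF.mul (.of_continuous ?_)) hc fun x hx => ?_
    · exact (hφ.continuous_fderiv (by simp)).clm_apply continuous_const
    · rw [fderiv_of_notMem_tsupport (𝕜 := ℝ) hx]
      simp
  · exact hF.integrable_mul hφ.continuous hc
  · rw [HasLineDerivAt]
    simp only [he]
    exact hasDerivAt_const _ _
  · exact ((hφ.differentiable (by simp)) x).hasFDerivAt.hasLineDerivAt e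

theorem EllipticCoeff.weakEq_harmonicCoord (ha : EllipticCoeff δ Λ a)
    (x₀ : EuclideanSpace ℝ (Fin n)) (k : Fin n) :
    WeakEq a N univ (harmonicCoord a N x₀ k) fun _ => 0 := by
  refine .of_smooth ha isOpen_univ (ha.lipschitzWith_harmonicCoord x₀ k).locallyLipschitz ?_
  intro φ hφ hc _
  have hF : ∀ i, IsLocBounded fun x : EuclideanSpace ℝ (Fin n) =>
      (if k = N then 0 else a (x N) i k) + a (x N) i N * harmonicSlope a N k (x N) := by
    intro i
    have hN : Measurable fun x : EuclideanSpace ℝ (Fin n) => x N := by fun_prop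
    have hb : ∀ i j, IsLocBounded fun x : EuclideanSpace ℝ (Fin n) => a (x N) i j := fun i j =>
      ⟨(ha.measurable i j).comp hN, fun _ _ => ⟨Λ, fun x _ => ha.bound _ _ _⟩⟩
    refine .add ?_ (.mul (hb i N) ⟨(ha.measurable_harmonicSlope k).comp hN,
      fun _ _ => ⟨_, fun x _ => ha.abs_harmonicSlope_le k _⟩⟩)
    split_ifs
    · exact .const 0
    · exact hb i k
  rw [integral_congr_ae ((ha.ae_energyForm_harmonicCoord x₀ k).mono fun x hx => hx _),
    integral_finsetSum _ fun i _ => ?_]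
  · refine Finset.sum_eq_zero fun i _ => integral_mul_fderiv_eq_zero (hF i) ?_ hφ hc
    intro x t
    by_cases hi : i = N
    · subst hi
      have h1 : ∀ s, a s i i * harmonicSlope a i k s = if k = i then 1 else - a s i k := by
        intro s
        have := (ha.diag_pos s i).ne'
        unfold harmonicSlope
        split_ifs <;> field_simp
      simp only [h1]
      split_ifs <;> simp
    · simp [Ne.symm hi]
  · refine (hF i).mul (.of_continuous ?_) |>.integrable (s := tsupport φ) hc fun x hx => ?_
    · exact (hφ.continuous_fderiv (by simp)).clm_apply continuous_const
    · rw [fderiv_of_notMem_tsupport (𝕜 := ℝ) hx]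
      simp

theorem harmonicCoord_of_eq {x₀ x : EuclideanSpace ℝ (Fin n)} (h : x N = x₀ N) (k : Fin n) :
    harmonicCoord a N x₀ k x = if k = N then 0 else x k - x₀ k := by
  simp [harmonicCoord, h]

theorem harmonicCoord_self (x₀ : EuclideanSpace ℝ (Fin n)) (k : Fin n) :
    harmonicCoord a N x₀ k x₀ = 0 := by
  simp [harmonicCoord]

theorem EllipticCoeff.harmonicCoord_last_nonneg (ha : EllipticCoeff δ Λ a)
    {x₀ x : EuclideanSpace ℝ (Fin n)} (h : x₀ N ≤ x N) : 0 ≤ harmonicCoord a N x₀ N x := by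
  simp only [harmonicCoord, harmonicSlope, if_true, zero_add]
  exact intervalIntegral.integral_nonneg h fun t _ => inv_nonneg.2 (ha.diag_pos t N).le

theorem EllipticCoeff.abs_last_sub_le (ha : EllipticCoeff δ Λ a)
    (x₀ x : EuclideanSpace ℝ (Fin n)) : |x N - x₀ N| ≤ Λ * |harmonicCoord a N x₀ N x| := by
  have hi : ∀ s t, IntervalIntegrable (fun t => (a t N N)⁻¹) volume s t := fun s t =>
    (ha.intervalIntegrable_harmonicSlope (N := N) N s t).congr fun r _ => if_pos rfl
  have key : ∀ s t, s ≤ t → t - s ≤ Λ * ∫ r in s..t, (a r N N)⁻¹ := by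
    intro s t hst
    have := intervalIntegral.integral_mono_on hst (intervalIntegrable_const (c := Λ⁻¹)) (hi s t)
      fun r _ => inv_anti₀ (ha.diag_pos r N) (ha.diag_le r N)
    rw [intervalIntegral.integral_const, smul_eq_mul] at this
    rw [← div_le_iff₀' (ha.bound_pos N)]
    simpa [div_eq_mul_inv] using this
  simp only [harmonicCoord, harmonicSlope, if_true, zero_add]
  rcases le_total (x₀ N) (x N) with h | h
  · rw [abs_of_nonneg (sub_nonneg.2 h)]
    exact (key _ _ h).trans (mul_le_mul_of_nonneg_left (le_abs_self _) (ha.bound_pos N).le)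
  · rw [abs_sub_comm, abs_of_nonneg (sub_nonneg.2 h), intervalIntegral.integral_symm, abs_neg]
    exact (key _ _ h).trans (mul_le_mul_of_nonneg_left (le_abs_self _) (ha.bound_pos N).le)

/-- The squared distance to the centre measured in harmonic coordinates. -/
noncomputable def harmonicSq (a : ℝ → Matrix (Fin n) (Fin n) ℝ) (N : Fin n)
    (x₀ x : EuclideanSpace ℝ (Fin n)) : ℝ := ∑ k, harmonicCoord a N x₀ k x ^ 2

theorem EllipticCoeff.abs_coord_sub_le (ha : EllipticCoeff δ Λ a)
    (x₀ x : EuclideanSpace ℝ (Fin n)) (k : Fin n) :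
    |x k - x₀ k| ≤ |harmonicCoord a N x₀ k x| +
      (Λ + (1 + Λ) / δ * Λ) * |harmonicCoord a N x₀ N x| := by
  have h1 := ha.delta_pos
  have h3 := ha.bound_pos N
  have h2 := ha.abs_last_sub_le (N := N) x₀ x
  by_cases hk : k = N
  · subst hk
    have : 0 ≤ (1 + Λ) / δ * Λ * |harmonicCoord a k x₀ k x| := by positivity
    nlinarith [abs_nonneg (harmonicCoord a k x₀ k x)]
  · have h4 : |∫ t in x₀ N..x N, harmonicSlope a N k t| ≤ (1 + Λ) / δ * |x N - x₀ N| :=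
      ha.abs_integral_harmonicSlope_le k _ _
    have h5 : (1 + Λ) / δ * |x N - x₀ N| ≤ (1 + Λ) / δ * (Λ * |harmonicCoord a N x₀ N x|) := by
      gcongr
    have h6 : x k - x₀ k = harmonicCoord a N x₀ k x - ∫ t in x₀ N..x N, harmonicSlope a N k t := by
      simp [harmonicCoord, hk]
    rw [h6]
    refine (abs_sub _ _).trans ?_
    nlinarith [mul_nonneg h3.le (abs_nonneg (harmonicCoord a N x₀ N x))]

theorem EllipticCoeff.dist_sq_le_harmonicSq (ha : EllipticCoeff δ Λ a)
    (x₀ x : EuclideanSpace ℝ (Fin n)) :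
    dist x x₀ ^ 2 ≤ (2 + n * (2 * (Λ + (1 + Λ) / δ * Λ) ^ 2)) * harmonicSq a N x₀ x := by
  set c := Λ + (1 + Λ) / δ * Λ
  rw [EuclideanSpace.dist_eq, Real.sq_sqrt (Finset.sum_nonneg fun _ _ => sq_nonneg _)]
  have h1 : harmonicCoord a N x₀ N x ^ 2 ≤ harmonicSq a N x₀ x :=
    Finset.single_le_sum (f := fun k => harmonicCoord a N x₀ k x ^ 2) (fun _ _ => sq_nonneg _)
      (Finset.mem_univ N)
  calc ∑ k, dist (x k) (x₀ k) ^ 2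
      ≤ ∑ k, (2 * harmonicCoord a N x₀ k x ^ 2 + 2 * c ^ 2 * harmonicSq a N x₀ x) := by
        refine Finset.sum_le_sum fun k _ => ?_
        have h2 := ha.abs_coord_sub_le (N := N) x₀ x k
        rw [Real.dist_eq]
        have h3 : |x k - x₀ k| ^ 2 ≤ (|harmonicCoord a N x₀ k x| +
          c * |harmonicCoord a N x₀ N x|) ^ 2 := by gcongr
        have h4 : c ^ 2 * harmonicCoord a N x₀ N x ^ 2 ≤ c ^ 2 * harmonicSq a N x₀ x := by gcongr
        rw [← sq_abs (harmonicCoord a N x₀ k x)]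
        rw [← sq_abs (harmonicCoord a N x₀ N x)] at h4
        nlinarith [sq_nonneg (|harmonicCoord a N x₀ k x| - c * |harmonicCoord a N x₀ N x|)]
    _ = _ := by
        rw [Finset.sum_add_distrib, ← Finset.mul_sum]
        simp [harmonicSq]
        ring

theorem EllipticCoeff.harmonicSq_le_dist_sq (ha : EllipticCoeff δ Λ a)
    (x₀ x : EuclideanSpace ℝ (Fin n)) :
    harmonicSq a N x₀ x ≤ n * (1 + (1 + Λ) / δ) ^ 2 * dist x x₀ ^ 2 := by
  have h1 := ha.delta_pos
  have h3 := ha.bound_pos N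
  calc harmonicSq a N x₀ x ≤ ∑ _k : Fin n, ((1 + (1 + Λ) / δ) * dist x x₀) ^ 2 := by
        refine Finset.sum_le_sum fun k _ => ?_
        rw [← sq_abs]
        have := (ha.lipschitzWith_harmonicCoord (N := N) x₀ k).dist_le_mul x x₀
        rw [Real.coe_toNNReal _ (by positivity), Real.dist_eq, harmonicCoord_self, sub_zero] at this
        gcongr
    _ = _ := by simp; ring

theorem EllipticCoeff.norm_fderiv_harmonicCoord_le (ha : EllipticCoeff δ Λ a)
    (x₀ x : EuclideanSpace ℝ (Fin n)) (k : Fin n) :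
    ‖fderiv ℝ (harmonicCoord a N x₀ k) x‖ ≤ 1 + (1 + Λ) / δ := by
  have h1 := ha.delta_pos
  have h3 := ha.bound_pos N
  have := norm_fderiv_le_of_lipschitz ℝ (ha.lipschitzWith_harmonicCoord (N := N) x₀ k) (x₀ := x)
  rwa [Real.coe_toNNReal _ (by positivity)] at this

theorem EllipticCoeff.locallyLipschitz_harmonicCoord (ha : EllipticCoeff δ Λ a)
    (x₀ : EuclideanSpace ℝ (Fin n)) (k : Fin n) : LocallyLipschitz (harmonicCoord a N x₀ k) :=
  (ha.lipschitzWith_harmonicCoord x₀ k).locallyLipschitz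

/-- The energy density of a harmonic coordinate. -/
noncomputable def harmonicEnergy (a : ℝ → Matrix (Fin n) (Fin n) ℝ) (N : Fin n)
    (x₀ : EuclideanSpace ℝ (Fin n)) (k : Fin n) (x : EuclideanSpace ℝ (Fin n)) : ℝ :=
  energyForm a N x (fderiv ℝ (harmonicCoord a N x₀ k) x) (fderiv ℝ (harmonicCoord a N x₀ k) x)

theorem EllipticCoeff.isLocBounded_harmonicEnergy (ha : EllipticCoeff δ Λ a)
    (x₀ : EuclideanSpace ℝ (Fin n)) (k : Fin n) : IsLocBounded (harmonicEnergy a N x₀ k) :=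
  ha.isLocBounded_energyForm (ha.locallyLipschitz_harmonicCoord x₀ k)
    (ha.locallyLipschitz_harmonicCoord x₀ k)

theorem EllipticCoeff.weakEq_harmonicCoord_sq (ha : EllipticCoeff δ Λ a)
    (x₀ : EuclideanSpace ℝ (Fin n)) (k : Fin n) :
    WeakEq a N univ (fun x => harmonicCoord a N x₀ k x ^ 2)
      fun x => 2 * harmonicEnergy a N x₀ k x := by
  have h := ha.weakEq_harmonicCoord (N := N) x₀ k
  have hl := ha.locallyLipschitz_harmonicCoord (N := N) x₀ k
  simp only [pow_two]
  exact (h.mul ha h hl hl (.const 0) (.const 0)).congr_right fun x => by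
    simp [harmonicEnergy]

theorem EllipticCoeff.weakEq_harmonicSq (ha : EllipticCoeff δ Λ a)
    (x₀ : EuclideanSpace ℝ (Fin n)) :
    WeakEq a N univ (harmonicSq a N x₀) fun x => ∑ k, 2 * harmonicEnergy a N x₀ k x := by
  refine WeakEq.finset_sum ha _ (fun k _ => ha.weakEq_harmonicCoord_sq x₀ k) (fun k _ => ?_)
    fun k _ => (ha.isLocBounded_harmonicEnergy x₀ k).const_mul 2
  simp only [pow_two]
  exact (ha.locallyLipschitz_harmonicCoord x₀ k).real_mul (ha.locallyLipschitz_harmonicCoord x₀ k)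

theorem EllipticCoeff.locallyLipschitz_harmonicSq (ha : EllipticCoeff δ Λ a)
    (x₀ : EuclideanSpace ℝ (Fin n)) : LocallyLipschitz (harmonicSq a N x₀) := by
  refine LocallyLipschitz.finset_sum _ fun k _ => ?_
  simp only [pow_two]
  exact (ha.locallyLipschitz_harmonicCoord x₀ k).real_mul (ha.locallyLipschitz_harmonicCoord x₀ k)

theorem EllipticCoeff.ae_harmonicEnergy_last (ha : EllipticCoeff δ Λ a)
    (x₀ : EuclideanSpace ℝ (Fin n)) : ∀ᵐ x, Λ⁻¹ ≤ harmonicEnergy a N x₀ N x := by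
  filter_upwards [ha.ae_hasFDerivAt_harmonicCoord (N := N) x₀ N] with x hx
  have h1 := ha.diag_pos (x N) N
  have h2 := ha.diag_le (x N) N
  have : harmonicEnergy a N x₀ N x = (a (x N) N N)⁻¹ := by
    rw [harmonicEnergy, hx.fderiv, energyForm_apply]
    simp [harmonicSlope]
    field_simp
  rw [this]
  exact inv_anti₀ h1 h2

theorem EllipticCoeff.harmonicEnergy_nonneg (ha : EllipticCoeff δ Λ a)
    (x₀ x : EuclideanSpace ℝ (Fin n)) (k : Fin n) : 0 ≤ harmonicEnergy a N x₀ k x :=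
  ha.energyForm_nonneg x _

theorem EllipticCoeff.harmonicEnergy_le (ha : EllipticCoeff δ Λ a)
    (x₀ x : EuclideanSpace ℝ (Fin n)) (k : Fin n) :
    harmonicEnergy a N x₀ k x ≤ n ^ 2 * Λ * (1 + (1 + Λ) / δ) ^ 2 := by
  have h1 := ha.delta_pos
  have h3 := ha.bound_pos N
  have h2 := ha.norm_fderiv_harmonicCoord_le (N := N) x₀ x k
  refine (le_abs_self _).trans ((ha.abs_energyForm_le x _ _).trans ?_)
  rw [mul_assoc, ← pow_two]
  gcongr

end HarmonicCoordinates

section Steklov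

open Filter Topology

variable {n : ℕ} {a : ℝ → Matrix (Fin n) (Fin n) ℝ} {N : Fin n} {δ Λ : ℝ} {h : ℝ} {K : NNReal}
  {V W : Set (EuclideanSpace ℝ (Fin n))} {f : EuclideanSpace ℝ (Fin n) → ℝ}
  {e x y : EuclideanSpace ℝ (Fin n)}

theorem energyForm_congr (hxy : x N = y N) : energyForm a N x = energyForm a N y := by
  ext L M
  simp only [energyForm_apply, hxy]

theorem WeakEq.translate (hf : WeakEq a N V f fun _ => 0) (he : e N = 0)
    (hW : ∀ x ∈ W, x + e ∈ V) : WeakEq a N W (fun x => f (x + e)) fun _ => 0 := by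
  intro φ h1 h2 h3
  have key := hf (fun y => φ (y - e)) (h1.comp
    (LipschitzWith.id.sub (LipschitzWith.const e)).locallyLipschitz)
    (h2.comp_homeomorph (Homeomorph.subRight e)) ?_
  · rw [← integral_sub_right_eq_self _ e]
    simp only [zero_mul, integral_zero, neg_zero] at key ⊢
    rw [← key]
    congr 1
    ext y
    have : (y - e) N = y N := by simp [he]
    rw [energyForm_congr this, fderiv_comp_add_right, fderiv_comp_sub, sub_add_cancel]
  · intro y hy
    have : tsupport (φ ∘ Homeomorph.subRight e) = _ := tsupport_comp_eq_preimage φ _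
    have hy' : y ∈ (Homeomorph.subRight e) ⁻¹' tsupport φ := this ▸ hy
    simpa using hW _ (h3 hy')

/-- The Steklov average of `f` over the segment from `x` to `x + h • e`. -/
noncomputable def steklov (f : EuclideanSpace ℝ (Fin n) → ℝ) (e : EuclideanSpace ℝ (Fin n)) (h : ℝ)
    (x : EuclideanSpace ℝ (Fin n)) : ℝ :=
  h⁻¹ * ∫ t in (0 : ℝ)..h, f (x + t • e)

theorem intervalIntegrable_comp_add_smul (hf : LipschitzWith K f) (s t : ℝ) :
    IntervalIntegrable (fun t => f (x + t • e)) volume s t :=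
  (hf.continuous.comp (by fun_prop)).intervalIntegrable _ _

theorem intervalIntegrable_fderiv_comp_add_smul (hf : LipschitzWith K f) (s t : ℝ) :
    IntervalIntegrable (fun t => fderiv ℝ f (x + t • e)) volume s t := by
  refine (intervalIntegrable_const (c := (K : ℝ))).mono_fun
    ((measurable_fderiv ℝ f).comp (by fun_prop)).aestronglyMeasurable
    (Eventually.of_forall fun r => ?_)
  simpa using norm_fderiv_le_of_lipschitz ℝ hf

theorem abs_steklov_le (hh : 0 < h) {m : ℝ} (hm : ∀ t ∈ Icc 0 h, |f (x + t • e)| ≤ m) :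
    |steklov f e h x| ≤ m := by
  have : ‖∫ t in (0 : ℝ)..h, f (x + t • e)‖ ≤ m * |h - 0| :=
    intervalIntegral.norm_integral_le_of_norm_le_const fun t ht => by
      rw [uIoc_of_le hh.le] at ht
      exact hm t ⟨ht.1.le, ht.2⟩
  rw [steklov, abs_mul, abs_inv, abs_of_pos hh, inv_mul_le_iff₀ hh]
  rw [sub_zero, abs_of_pos hh, Real.norm_eq_abs] at this
  linarith

theorem lipschitzWith_steklov (hf : LipschitzWith K f) (hh : 0 < h) :
    LipschitzWith K (steklov f e h) := by
  refine LipschitzWith.of_dist_le_mul fun x y => ?_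
  have h1 : steklov f e h x - steklov f e h y =
      h⁻¹ * ∫ t in (0 : ℝ)..h, (f (x + t • e) - f (y + t • e)) := by
    rw [intervalIntegral.integral_sub (intervalIntegrable_comp_add_smul hf _ _)
      (intervalIntegrable_comp_add_smul hf _ _), mul_sub]
    rfl
  have h2 : ‖∫ t in (0 : ℝ)..h, (f (x + t • e) - f (y + t • e))‖ ≤ K * dist x y * |h - 0| :=
    intervalIntegral.norm_integral_le_of_norm_le_const fun t _ => by
      simpa [Real.dist_eq] using hf.dist_le_mul (x + t • e) (y + t • e)
  rw [Real.dist_eq, h1, abs_mul, abs_inv, abs_of_pos hh, inv_mul_le_iff₀ hh]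
  rw [sub_zero, abs_of_pos hh, Real.norm_eq_abs] at h2
  linarith

theorem hasFDerivAt_steklov (hf : LipschitzWith K f) (hh : 0 < h)
    (hd : ∀ t ∈ Icc 0 h, DifferentiableAt ℝ f (x + t • e)) :
    HasFDerivAt (steklov f e h) (h⁻¹ • ∫ t in (0 : ℝ)..h, fderiv ℝ f (x + t • e)) x := by
  have key := intervalIntegral.hasFDerivAt_integral_of_dominated_loc_of_lip (μ := volume) (𝕜 := ℝ)
    (F := fun x t => f (x + t • e)) (F' := fun t => fderiv ℝ f (x + t • e))
    (x₀ := x) (bound := fun _ => K) (s := univ) (a := 0) (b := h) univ_mem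
    (Eventually.of_forall fun y => ?_) ?_ ?_ ?_ ?_ ?_
  · exact key.2.const_mul h⁻¹
  · exact (hf.continuous.comp (by fun_prop)).aestronglyMeasurable
  · exact intervalIntegrable_comp_add_smul hf _ _
  · exact ((measurable_fderiv ℝ f).comp (by fun_prop)).aestronglyMeasurable
  · refine Eventually.of_forall fun t _ => LipschitzWith.lipschitzOnWith ?_
    refine LipschitzWith.of_dist_le_mul fun y z => ?_
    simpa using hf.dist_le_mul (y + t • e) (z + t • e)
  · exact intervalIntegrable_const
  · refine Eventually.of_forall fun t ht => ?_
    rw [uIoc_of_le hh.le] at ht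
    exact (hasFDerivAt_comp_add_right (t • e)).2 (hd t ⟨ht.1.le, ht.2⟩).hasFDerivAt

theorem fderiv_steklov_apply (hf : LipschitzWith K f) (hh : 0 < h)
    (hd : ∀ t ∈ Icc 0 h, DifferentiableAt ℝ f (x + t • e)) :
    fderiv ℝ (steklov f e h) x e = h⁻¹ * (f (x + h • e) - f x) := by
  have hi := intervalIntegrable_fderiv_comp_add_smul (x := x) (e := e) hf 0 h
  rw [(hasFDerivAt_steklov hf hh hd).fderiv, _root_.smul_apply, smul_eq_mul,
    ContinuousLinearMap.intervalIntegral_apply hi]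
  congr 1
  have := intervalIntegral.integral_eq_sub_of_hasDerivAt (a := 0) (b := h)
    (f := fun t : ℝ => f (x + t • e)) (f' := fun t => fderiv ℝ f (x + t • e) e) (fun t ht => ?_) ?_
  · simpa using this
  · rw [uIcc_of_le hh.le] at ht
    have h1 : HasDerivAt (fun t : ℝ => x + t • e) e t := by
      simpa using ((hasDerivAt_id t).smul_const e).const_add x
    exact (hd t ht).hasFDerivAt.comp_hasDerivAt t h1
  · exact (intervalIntegrable_iff_integrableOn_Ioc_of_le hh.le).2
      ((ContinuousLinearMap.apply ℝ ℝ e).integrable_comp hi.1)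

theorem WeakEq.steklov (ha : EllipticCoeff δ Λ a) (hf : LipschitzWith K f)
    (hw : WeakEq a N V f fun _ => 0) (hd : ∀ x ∈ V, DifferentiableAt ℝ f x) (he : e N = 0)
    (hh : 0 < h) (hW : ∀ x ∈ W, ∀ t ∈ Icc 0 h, x + t • e ∈ V) :
    WeakEq a N W (steklov f e h) fun _ => 0 := by
  intro φ h1 h2 h3
  obtain ⟨D, hD⟩ := h1.exists_lipschitzWith_of_hasCompactSupport h2
  have hx : ∀ x, energyForm a N x (fderiv ℝ (_root_.steklov f e h) x) (fderiv ℝ φ x) =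
      h⁻¹ * ∫ t in (0 : ℝ)..h, energyForm a N x (fderiv ℝ f (x + t • e)) (fderiv ℝ φ x) := by
    intro x
    by_cases hx : x ∈ tsupport φ
    · have := ContinuousLinearMap.intervalIntegral_comp_comm
        (LinearMap.toContinuousLinearMap ((energyForm a N x).flip (fderiv ℝ φ x)))
        (intervalIntegrable_fderiv_comp_add_smul (x := x) (e := e) hf 0 h)
      simp only [LinearMap.coe_toContinuousLinearMap', LinearMap.flip_apply] at this
      rw [this, (hasFDerivAt_steklov hf hh fun t ht => hd _ (hW x (h3 hx) t ht)).fderiv, map_smul]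
      rfl
    · simp [fderiv_of_notMem_tsupport (𝕜 := ℝ) hx]
  have hint : Integrable (Function.uncurry fun (t : ℝ) (x : EuclideanSpace ℝ (Fin n)) =>
      energyForm a N x (fderiv ℝ f (x + t • e)) (fderiv ℝ φ x))
      ((volume.restrict (Ioc 0 h)).prod volume) := by
    have hb : Integrable ((tsupport φ).indicator fun _ : EuclideanSpace ℝ (Fin n) =>
        n ^ 2 * Λ * K * D) := by
      rw [integrable_indicator_iff (isClosed_tsupport φ).measurableSet]
      exact integrableOn_const (IsCompact.measure_lt_top h2).ne
    refine (hb.comp_snd (volume.restrict (Ioc 0 h))).mono' ?_ (Eventually.of_forall fun p => ?_)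
    · exact (ha.measurable_energyForm measurable_snd
        ((measurable_fderiv ℝ f).comp (by fun_prop : Measurable
          fun p : ℝ × EuclideanSpace ℝ (Fin n) => p.2 + p.1 • e))
        ((measurable_fderiv ℝ φ).comp measurable_snd)).aestronglyMeasurable
    · rcases p with ⟨t, x⟩
      by_cases hx : x ∈ tsupport φ
      · rw [indicator_of_mem hx]
        refine (ha.abs_energyForm_le x _ _).trans ?_
        have := ha.bound_nonneg N
        gcongr
        exacts [norm_fderiv_le_of_lipschitz ℝ hf, norm_fderiv_le_of_lipschitz ℝ hD]
      · simp [Function.uncurry, fderiv_of_notMem_tsupport (𝕜 := ℝ) hx, hx]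
  simp only [hx, intervalIntegral.integral_of_le hh.le]
  rw [integral_const_mul, ← integral_integral_swap hint]
  have : ∀ t ∈ Ioc 0 h, ∫ x, energyForm a N x (fderiv ℝ f (x + t • e)) (fderiv ℝ φ x) = 0 := by
    intro t ht
    have := hw.translate (W := W) (e := t • e) (by simp [he]) (fun x hx => hW x hx t ⟨ht.1.le, ht.2⟩)
      φ h1 h2 h3
    simpa [fderiv_comp_add_right] using this
  rw [setIntegral_congr_fun measurableSet_Ioc this]
  simp

/-- The difference quotient of `f` in direction `e` with step `h`. -/
noncomputable def diffQuot (f : EuclideanSpace ℝ (Fin n) → ℝ) (e : EuclideanSpace ℝ (Fin n)) (h : ℝ)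
    (x : EuclideanSpace ℝ (Fin n)) : ℝ :=
  h⁻¹ * (f (x + h • e) + (-1) * f x)

theorem exists_lipschitzWith_diffQuot (hf : LipschitzWith K f) :
    ∃ K', LipschitzWith K' (diffQuot f e h) := by
  refine ⟨Real.toNNReal (|h⁻¹| * (2 * K)), LipschitzWith.of_dist_le_mul fun x y => ?_⟩
  have h1 := hf.dist_le_mul (x + h • e) (y + h • e)
  have h2 := hf.dist_le_mul x y
  rw [dist_add_right] at h1
  rw [Real.coe_toNNReal _ (by positivity)]
  rw [Real.dist_eq] at h1 h2 ⊢
  have : diffQuot f e h x - diffQuot f e h y =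
    h⁻¹ * ((f (x + h • e) - f (y + h • e)) - (f x - f y)) := by unfold diffQuot; ring
  rw [this, abs_mul, mul_assoc]
  refine mul_le_mul_of_nonneg_left ((abs_sub _ _).trans ?_) (abs_nonneg _)
  linarith

theorem differentiableAt_diffQuot (h1 : DifferentiableAt ℝ f x)
    (h2 : DifferentiableAt ℝ f (x + h • e)) : DifferentiableAt ℝ (diffQuot f e h) x :=
  (((differentiableAt_comp_add_right (h • e)).2 h2).add (h1.const_mul (-1))).const_mul _

theorem WeakEq.diffQuot (ha : EllipticCoeff δ Λ a) (hf : LipschitzWith K f)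
    (hw : WeakEq a N V f fun _ => 0) (he : e N = 0) (hWV : W ⊆ V)
    (hW : ∀ x ∈ W, x + h • e ∈ V) : WeakEq a N W (diffQuot f e h) fun _ => 0 := by
  have hl : LocallyLipschitz fun x => f (x + h • e) := hf.locallyLipschitz.comp
    (LipschitzWith.id.add (LipschitzWith.const (h • e))).locallyLipschitz
  have h1 := hw.translate (W := W) (e := h • e) (by simp [he]) hW
  have h2 := (hw.mono hWV).const_mul (-1) hf.locallyLipschitz
  have h3 := h1.add ha h2 hl (hf.locallyLipschitz.real_const_mul (-1)) (.const 0)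
    ((IsLocBounded.const 0).const_mul _)
  exact (h3.const_mul h⁻¹ (hl.add (hf.locallyLipschitz.real_const_mul (-1)))).congr_right
    fun x => by simp

end Steklov

section TangentialEstimate

open Filter Topology

variable {n : ℕ} {a : ℝ → Matrix (Fin n) (Fin n) ℝ} {N : Fin n} {δ Λ : ℝ} {h r m : ℝ} {K : NNReal}
  {f : EuclideanSpace ℝ (Fin n) → ℝ} {e x₀ : EuclideanSpace ℝ (Fin n)}

/-- A constant `B` with `|x - x₀|² ≤ B * harmonicSq a N x₀ x`. -/
noncomputable def distConst (n : ℕ) (δ Λ : ℝ) : ℝ := 2 + n * (2 * (Λ + (1 + Λ) / δ * Λ) ^ 2)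

theorem distConst_pos (n : ℕ) (δ Λ : ℝ) : 0 < distConst n δ Λ := by
  unfold distConst
  positivity

/-- An upper bound for `div (a(xᴺ) ∇ (harmonicSq a N x₀))`. -/
noncomputable def energyConst (n : ℕ) (δ Λ : ℝ) : ℝ :=
  n * (2 * (n ^ 2 * Λ * (1 + (1 + Λ) / δ) ^ 2))

theorem EllipticCoeff.energyConst_nonneg (ha : EllipticCoeff δ Λ a) (N : Fin n) :
    0 ≤ energyConst n δ Λ := by
  have h1 := ha.delta_pos
  have h3 := ha.bound_pos N
  unfold energyConst
  positivity

theorem EllipticCoeff.sum_harmonicEnergy_le (ha : EllipticCoeff δ Λ a)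
    (x₀ x : EuclideanSpace ℝ (Fin n)) :
    ∑ k, 2 * harmonicEnergy a N x₀ k x ≤ energyConst n δ Λ :=
  (Finset.sum_le_sum fun k _ =>
    mul_le_mul_of_nonneg_left (ha.harmonicEnergy_le x₀ x k) zero_le_two).trans_eq
    (by simp [energyConst])

theorem EllipticCoeff.ae_sum_harmonicEnergy_pos (ha : EllipticCoeff δ Λ a)
    (x₀ : EuclideanSpace ℝ (Fin n)) : ∀ᵐ x, 0 < ∑ k, 2 * harmonicEnergy a N x₀ k x := by
  filter_upwards [ha.ae_harmonicEnergy_last (N := N) x₀] with x hx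
  refine Finset.sum_pos' (fun k _ => mul_nonneg zero_le_two (ha.harmonicEnergy_nonneg x₀ x k))
    ⟨N, Finset.mem_univ N, ?_⟩
  have := inv_pos.2 (ha.bound_pos N)
  linarith

theorem EllipticCoeff.isLocBounded_sum_harmonicEnergy (ha : EllipticCoeff δ Λ a)
    (x₀ : EuclideanSpace ℝ (Fin n)) :
    IsLocBounded fun x => ∑ k, 2 * harmonicEnergy a N x₀ k x :=
  .finset_sum _ fun k _ => (ha.isLocBounded_harmonicEnergy x₀ k).const_mul 2

theorem EllipticCoeff.ae_norm_fderiv_harmonicSq_sq_le (ha : EllipticCoeff δ Λ a)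
    (x₀ : EuclideanSpace ℝ (Fin n)) : ∀ᵐ x, ‖fderiv ℝ (harmonicSq a N x₀) x‖ ^ 2 ≤
      n ^ 2 * (4 * (1 + (1 + Λ) / δ) ^ 2) * harmonicSq a N x₀ x := by
  have h1 := ha.delta_pos
  have h3 := ha.bound_pos N
  have : ∀ᵐ x, ∀ k, DifferentiableAt ℝ (harmonicCoord a N x₀ k) x :=
    ae_all_iff.2 fun k => (ha.locallyLipschitz_harmonicCoord x₀ k).ae_differentiableAt
  filter_upwards [this] with x hx
  set A := 1 + (1 + Λ) / δ with hA
  have hA0 : 0 ≤ A := by positivity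
  have hq0 : 0 ≤ harmonicSq a N x₀ x := Finset.sum_nonneg fun _ _ => sq_nonneg _
  have hD : HasFDerivAt (harmonicSq a N x₀) (∑ k, (2 * harmonicCoord a N x₀ k x) •
      fderiv ℝ (harmonicCoord a N x₀ k) x) x := by
    refine HasFDerivAt.fun_sum fun k _ => ?_
    simpa using (hx k).hasFDerivAt.pow 2
  have hle : ‖fderiv ℝ (harmonicSq a N x₀) x‖ ≤ n * (2 * √(harmonicSq a N x₀ x) * A) := by
    rw [hD.fderiv]
    refine (norm_sum_le _ _).trans ((Finset.sum_le_sum (g := fun _ =>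
      2 * √(harmonicSq a N x₀ x) * A) fun k _ => ?_).trans_eq (by simp))
    rw [norm_smul, norm_mul, Real.norm_two, Real.norm_eq_abs]
    have h4 : |harmonicCoord a N x₀ k x| ≤ √(harmonicSq a N x₀ x) :=
      Real.abs_le_sqrt (Finset.single_le_sum (f := fun k => harmonicCoord a N x₀ k x ^ 2)
        (fun _ _ => sq_nonneg _) (Finset.mem_univ k))
    have h5 := ha.norm_fderiv_harmonicCoord_le (N := N) x₀ x k
    gcongr
  calc ‖fderiv ℝ (harmonicSq a N x₀) x‖ ^ 2 ≤ (n * (2 * √(harmonicSq a N x₀ x) * A)) ^ 2 := by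
        gcongr
    _ = n ^ 2 * (4 * A ^ 2) * √(harmonicSq a N x₀ x) ^ 2 := by ring
    _ = _ := by rw [Real.sq_sqrt hq0]

theorem EllipticCoeff.dist_lt_of_harmonicSq_le (ha : EllipticCoeff δ Λ a) (hr : 0 < r)
    {x : EuclideanSpace ℝ (Fin n)} (hx : harmonicSq a N x₀ x ≤ r ^ 2 / (2 * distConst n δ Λ)) :
    dist x x₀ < r := by
  have hB := distConst_pos n δ Λ
  have h1 : dist x x₀ ^ 2 ≤ distConst n δ Λ * harmonicSq a N x₀ x := ha.dist_sq_le_harmonicSq x₀ x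
  rw [le_div_iff₀ (by positivity)] at hx
  refine lt_of_pow_lt_pow_left₀ 2 hr.le ?_
  nlinarith [pow_pos hr 2]

theorem EllipticCoeff.bernstein_nonneg (ha : EllipticCoeff δ Λ a) {x : EuclideanSpace ℝ (Fin n)}
    {M L P : EuclideanSpace ℝ (Fin n) →L[ℝ] ℝ} {η w G R c d : ℝ} (hη0 : 0 ≤ η) (hηR : η ≤ R)
    (hG : G ≤ c) (hc : 0 ≤ c) (hM : ‖M‖ ^ 2 ≤ d * R) (hP : w ^ 2 ≤ ‖P‖ ^ 2) (N : Fin n) :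
    0 ≤ (η * w) * (w * (-G) + 2 * energyForm a N x M L) +
      (η * w) * (w * (-G) + 2 * energyForm a N x M L) +
      2 * energyForm a N x (η • L + w • M) (η • L + w • M) +
      R * ((c + 3 * (n ^ 2 * Λ) * d) / δ) * (2 * energyForm a N x P P) := by
  have hδ := ha.delta_pos
  have hΛ := ha.bound_nonneg N
  have h1 := ha.energyForm_nonneg (N := N) x (η • L + (2 * w) • M)
  have h2 := ha.mul_norm_sq_le_energyForm (N := N) x P
  have h3 : energyForm a N x M M ≤ n ^ 2 * Λ * (d * R) := by
    refine (le_abs_self _).trans ((ha.abs_energyForm_le x M M).trans ?_)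
    rw [mul_assoc, ← pow_two]
    gcongr
  have hcomm := ha.energyForm_comm (N := N) x L M
  simp only [map_add, map_smul, LinearMap.add_apply, LinearMap.smul_apply, smul_eq_mul] at h1 ⊢
  rw [hcomm] at h1 ⊢
  have hd : 0 ≤ d * R := (sq_nonneg _).trans hM
  have hR : 0 ≤ R := hη0.trans hηR
  have h4 : η * G ≤ R * c := (mul_le_mul_of_nonneg_left hG hη0).trans (by gcongr)
  have h5 : w ^ 2 * (R * c + 3 * (n ^ 2 * Λ * (d * R))) ≤
      R * ((c + 3 * (n ^ 2 * Λ) * d) / δ) * energyForm a N x P P := by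
    have h6 : R * ((c + 3 * (n ^ 2 * Λ) * d) / δ) * δ = R * c + 3 * (n ^ 2 * Λ * (d * R)) := by
      field_simp
    have h7 : 0 ≤ R * c + 3 * (n ^ 2 * Λ * (d * R)) := by positivity
    have h8 : 0 ≤ R * ((c + 3 * (n ^ 2 * Λ) * d) / δ) := by
      rw [← h6] at h7
      exact nonneg_of_mul_nonneg_left h7 hδ
    calc w ^ 2 * (R * c + 3 * (n ^ 2 * Λ * (d * R)))
        ≤ ‖P‖ ^ 2 * (R * c + 3 * (n ^ 2 * Λ * (d * R))) := by gcongr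
      _ = R * ((c + 3 * (n ^ 2 * Λ) * d) / δ) * (δ * ‖P‖ ^ 2) := by rw [← h6]; ring
      _ ≤ _ := by gcongr
  nlinarith [mul_le_mul_of_nonneg_left h4 (sq_nonneg w), mul_le_mul_of_nonneg_left h3 (sq_nonneg w)]

/-- The constant of the tangential derivative estimate. -/
noncomputable def tangentialConst (n : ℕ) (δ Λ : ℝ) : ℝ :=
  √(2 * distConst n δ Λ * ((energyConst n δ Λ +
    3 * (n ^ 2 * Λ) * (n ^ 2 * (4 * (1 + (1 + Λ) / δ) ^ 2))) / δ))

theorem EllipticCoeff.abs_diffQuot_le (ha : EllipticCoeff δ Λ a) (hf : LipschitzWith K f)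
    (hr : 0 < r) (hd : ∀ x ∈ ball x₀ (2 * r), DifferentiableAt ℝ f x)
    (hw : WeakEq a N (ball x₀ (2 * r)) f fun _ => 0) (he : e N = 0) (he1 : ‖e‖ ≤ 1) (hh : 0 < h)
    (hhr : h < r) (hm : ∀ x ∈ ball x₀ (2 * r), |f x| ≤ m) :
    |diffQuot f e h x₀| ≤ tangentialConst n δ Λ * m / r := by
  have hB := distConst_pos n δ Λ
  have hc := ha.energyConst_nonneg N
  set c := energyConst n δ Λ with hcdef
  set d : ℝ := n ^ 2 * (4 * (1 + (1 + Λ) / δ) ^ 2) with hddef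
  set R := r ^ 2 / (2 * distConst n δ Λ) with hR
  have hR0 : 0 < R := by positivity
  set k := (c + 3 * (n ^ 2 * Λ) * d) / δ with hk
  have hk0 : 0 ≤ k := by
    have := ha.bound_pos N
    have := ha.delta_pos
    positivity
  set q := harmonicSq a N x₀ with hq
  set z := _root_.steklov f e h with hz
  set w := _root_.diffQuot f e h with hwdef
  have hmem : ∀ x ∈ ball x₀ r, ∀ t ∈ Icc 0 h, x + t • e ∈ ball x₀ (2 * r) := by
    intro x hx t ht
    rw [mem_ball] at hx ⊢
    have h1 : dist (x + t • e) x ≤ t := by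
      rw [dist_eq_norm, add_sub_cancel_left, norm_smul, Real.norm_of_nonneg ht.1]
      nlinarith [ht.1]
    linarith [dist_triangle (x + t • e) x x₀, ht.2]
  have hsub : ball x₀ r ⊆ ball x₀ (2 * r) := ball_subset_ball (by linarith)
  have hmem' : ∀ x ∈ ball x₀ r, x + h • e ∈ ball x₀ (2 * r) := fun x hx =>
    hmem x hx h ⟨hh.le, le_rfl⟩
  have hm0 : 0 ≤ m := (abs_nonneg _).trans (hm x₀ (mem_ball_self (by linarith)))
  have hzl : LocallyLipschitz z := (lipschitzWith_steklov hf hh).locallyLipschitz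
  obtain ⟨K', hK'⟩ := exists_lipschitzWith_diffQuot (e := e) (h := h) hf
  have hwl : LocallyLipschitz w := hK'.locallyLipschitz
  have hql : LocallyLipschitz q := ha.locallyLipschitz_harmonicSq x₀
  have hzw : WeakEq a N (ball x₀ r) z fun _ => 0 := hw.steklov ha hf hd he hh hmem
  have hww : WeakEq a N (ball x₀ r) w fun _ => 0 := hw.diffQuot ha hf he hsub hmem'
  have hqw : WeakEq a N (ball x₀ r) q fun x => ∑ k, 2 * harmonicEnergy a N x₀ k x :=
    (ha.weakEq_harmonicSq x₀).mono (subset_univ _)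
  set G := fun x => ∑ k, 2 * harmonicEnergy a N x₀ k x with hG
  have hGb : IsLocBounded G := ha.isLocBounded_sum_harmonicEnergy x₀
  let η : EuclideanSpace ℝ (Fin n) → ℝ := fun x => R + (-1) * q x
  have hηl : LocallyLipschitz η := (LocallyLipschitz.const R).add (hql.real_const_mul (-1))
  have hηw : WeakEq a N (ball x₀ r) η fun x => -G x :=
    ((weakEq_const R).add ha (hqw.const_mul (-1) hql) (.const R) (hql.real_const_mul (-1))
      (.const 0) (hGb.const_mul (-1))).congr_right fun x => by simp
  have hGb' : IsLocBounded fun x => -G x := by simpa using hGb.const_mul (-1)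
  have hηwl : LocallyLipschitz fun x => η x * w x := hηl.real_mul hwl
  have h1 := (hηw.mul ha hww hηl hwl hGb' (.const 0)).congr_right
    (g₂ := fun x => w x * (-G x) + 2 * energyForm a N x (fderiv ℝ η x) (fderiv ℝ w x))
    fun x => by ring
  have hb1 : IsLocBounded fun x =>
      w x * (-G x) + 2 * energyForm a N x (fderiv ℝ η x) (fderiv ℝ w x) :=
    ((IsLocBounded.of_continuous hwl.continuous).mul hGb').add
      ((ha.isLocBounded_energyForm hηl hwl).const_mul 2)
  have h2 := h1.mul ha h1 hηwl hηwl hb1 hb1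
  have hb2 := (((IsLocBounded.of_continuous hηwl.continuous).mul hb1).add
    ((IsLocBounded.of_continuous hηwl.continuous).mul hb1)).add
      ((ha.isLocBounded_energyForm (N := N) hηwl hηwl).const_mul 2)
  have h3 := (hzw.mul ha hzw hzl hzl (.const 0) (.const 0)).congr_right
    (g₂ := fun x => 2 * energyForm a N x (fderiv ℝ z x) (fderiv ℝ z x)) fun x => by ring
  have hb3 := (ha.isLocBounded_energyForm (N := N) hzl hzl).const_mul 2
  have hz2l := hzl.real_mul hzl
  have h4 := (h3.const_mul (R * k) hz2l).add ha (weakEq_const (-(R * k * m ^ 2)))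
    (hz2l.real_const_mul (R * k)) (.const _) (hb3.const_mul (R * k)) (.const 0)
  have h5 := h2.add ha h4 (hηwl.real_mul hηwl) ((hz2l.real_const_mul (R * k)).add (.const _))
    hb2 ((hb3.const_mul (R * k)).add (.const 0))
  have hΩ : IsOpen {x | q x < R} := isOpen_lt hql.continuous continuous_const
  have hcl : closure {x | q x < R} ⊆ {x | q x ≤ R} :=
    closure_lt_subset_le hql.continuous continuous_const
  have hle : ∀ x, q x ≤ R → x ∈ ball x₀ r := fun x hx => ha.dist_lt_of_harmonicSq_le hr hx
  have key := h5.nonpos_of_frontier ha (Ω := {x | q x < R})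
    ((hηwl.real_mul hηwl).add ((hz2l.real_const_mul (R * k)).add (.const _))) hqw hGb hΩ
    ((isCompact_closedBall x₀ r).of_isClosed_subset isClosed_closure
      fun x hx => ball_subset_closedBall (hle x (hcl hx)))
    (fun x hx => hle x (hcl hx)) ?_
    ((ha.ae_sum_harmonicEnergy_pos x₀).mono fun x hx _ => hx) ?_ x₀ ?_
  · have hq0 : q x₀ = 0 := by simp [hq, harmonicSq, harmonicCoord_self]
    simp only [η, hq0] at key
    have h6 : (r * w x₀) ^ 2 ≤ 2 * distConst n δ Λ * k * m ^ 2 := by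
      have h7 : R * w x₀ ^ 2 ≤ k * m ^ 2 := by
        refine le_of_mul_le_mul_left ?_ hR0
        nlinarith [mul_nonneg (mul_nonneg hR0.le hk0) (sq_nonneg (z x₀)), key]
      have h8 : 2 * distConst n δ Λ * R = r ^ 2 := by
        rw [hR]
        field_simp
      calc (r * w x₀) ^ 2 = 2 * distConst n δ Λ * (R * w x₀ ^ 2) := by
            rw [mul_pow, ← h8]; ring
        _ ≤ 2 * distConst n δ Λ * (k * m ^ 2) := by gcongr
        _ = _ := by ring
    have h7 := Real.abs_le_sqrt h6
    rw [Real.sqrt_mul' _ (sq_nonneg m), Real.sqrt_sq hm0, abs_mul, abs_of_pos hr] at h7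
    rw [le_div_iff₀' hr]
    exact h7
  · filter_upwards [ha.ae_norm_fderiv_harmonicSq_sq_le (N := N) x₀, hηl.ae_differentiableAt,
      hwl.ae_differentiableAt, hql.ae_differentiableAt] with x hx1 hx2 hx3 hx4 hx5
    have hxr := hle x (le_of_lt hx5)
    have hη : fderiv ℝ η x = -fderiv ℝ q x :=
      ((hx4.hasFDerivAt.const_mul (-1)).const_add R).fderiv.trans (by simp)
    have hηw' : fderiv ℝ (fun x => η x * w x) x = η x • fderiv ℝ w x + w x • fderiv ℝ η x :=
      fderiv_fun_mul hx2 hx3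
    have hx5' : q x ≤ R := le_of_lt hx5
    have hqnn : 0 ≤ q x := Finset.sum_nonneg fun _ _ => sq_nonneg _
    have hwz : w x = fderiv ℝ z x e := by
      rw [fderiv_steklov_apply hf hh fun t ht => hd _ (hmem x hxr t ht)]
      simp [hwdef, diffQuot, sub_eq_add_neg]
    have hwn : w x ^ 2 ≤ ‖fderiv ℝ z x‖ ^ 2 := by
      rw [sq_le_sq, abs_norm, hwz]
      exact ((fderiv ℝ z x).le_of_opNorm_le le_rfl e).trans
        (mul_le_of_le_one_right (norm_nonneg _) he1)
    rw [hηw']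
    have := ha.bernstein_nonneg (x := x) (M := fderiv ℝ η x) (L := fderiv ℝ w x)
      (P := fderiv ℝ z x) (η := η x) (w := w x) (G := G x) (R := R) (c := c) (d := d)
      (by simp only [η]; linarith) (by simp only [η]; linarith)
      (ha.sum_harmonicEnergy_le x₀ x) hc ?_ hwn N
    · simpa using this
    · rw [hη, norm_neg]
      refine hx1.trans ?_
      gcongr
  · intro x hx
    have hqx : q x = R := frontier_lt_subset_eq hql.continuous continuous_const hx
    have hxr := hle x hqx.le
    have hzm : |z x| ≤ m := abs_steklov_le hh fun t ht => hm _ (hmem x hxr t ht)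
    have hz2 : z x * z x ≤ m ^ 2 := by
      rw [← pow_two, ← sq_abs]
      gcongr
    simp only [η, hqx]
    nlinarith [mul_le_mul_of_nonneg_left hz2 (mul_nonneg hR0.le hk0)]
  · have hq0 : q x₀ = 0 := by simp [hq, harmonicSq, harmonicCoord_self]
    simpa [hq0] using hR0

end TangentialEstimate

section NormalEstimate

open Filter Topology

variable {n : ℕ} {a : ℝ → Matrix (Fin n) (Fin n) ℝ} {N : Fin n} {δ Λ : ℝ} {h r m : ℝ} {K : NNReal}
  {f : EuclideanSpace ℝ (Fin n) → ℝ} {e x₀ : EuclideanSpace ℝ (Fin n)}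

theorem tangentialConst_nonneg (n : ℕ) (δ Λ : ℝ) : 0 ≤ tangentialConst n δ Λ :=
  Real.sqrt_nonneg _

theorem tendsto_diffQuot (hd : DifferentiableAt ℝ f x₀) :
    Tendsto (fun s => diffQuot f e s x₀) (𝓝[>] 0) (𝓝 (fderiv ℝ f x₀ e)) := by
  have := (hd.hasFDerivAt.hasLineDerivAt e).tendsto_slope_zero_right
  refine this.congr fun s => ?_
  simp [diffQuot, sub_eq_add_neg]

theorem EllipticCoeff.abs_fderiv_le (ha : EllipticCoeff δ Λ a) (hf : LipschitzWith K f)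
    (hr : 0 < r) (hd : ∀ x ∈ ball x₀ (2 * r), DifferentiableAt ℝ f x)
    (hw : WeakEq a N (ball x₀ (2 * r)) f fun _ => 0) (he : e N = 0) (he1 : ‖e‖ ≤ 1)
    (hm : ∀ x ∈ ball x₀ (2 * r), |f x| ≤ m) :
    |fderiv ℝ f x₀ e| ≤ tangentialConst n δ Λ * m / r := by
  refine le_of_tendsto (tendsto_diffQuot (hd x₀ (mem_ball_self (by linarith)))).abs ?_
  filter_upwards [Ioo_mem_nhdsGT hr] with s hs
  exact ha.abs_diffQuot_le hf hr hd hw he he1 hs.1 hs.2 hm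

theorem EllipticCoeff.abs_diffQuot_diffQuot_le (ha : EllipticCoeff δ Λ a) (hf : LipschitzWith K f)
    (hr : 0 < r) (hd : ∀ x ∈ ball x₀ (4 * r), DifferentiableAt ℝ f x)
    (hw : WeakEq a N (ball x₀ (4 * r)) f fun _ => 0) (he : e N = 0) (he1 : ‖e‖ ≤ 1)
    (hm : ∀ x ∈ ball x₀ (4 * r), |f x| ≤ m) {s : ℝ} (hs : 0 < s) (hsr : s < r) (hh : 0 < h)
    (hhr : h < r) :
    |diffQuot (diffQuot f e s) e h x₀| ≤ tangentialConst n δ Λ ^ 2 * m / r ^ 2 := by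
  have hsub : ∀ y ∈ ball x₀ (2 * r), ball y (2 * r) ⊆ ball x₀ (4 * r) := fun y hy =>
    ball_subset_ball' (by rw [mem_ball] at hy; linarith)
  have hmem : ∀ y ∈ ball x₀ (2 * r), y + s • e ∈ ball x₀ (4 * r) := fun y hy => by
    refine hsub y hy ?_
    rw [mem_ball, dist_eq_norm, add_sub_cancel_left, norm_smul, Real.norm_of_nonneg hs.le]
    nlinarith
  have hsub' : ball x₀ (2 * r) ⊆ ball x₀ (4 * r) := ball_subset_ball (by linarith)
  obtain ⟨K', hK'⟩ := exists_lipschitzWith_diffQuot (e := e) (h := s) hf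
  refine (ha.abs_diffQuot_le (m := tangentialConst n δ Λ * m / r) hK' hr (fun x hx => ?_)
    (hw.diffQuot ha hf he hsub' hmem) he he1 hh hhr fun y hy => ?_).trans_eq ?_
  · exact differentiableAt_diffQuot (hd x (hsub' hx)) (hd _ (hmem x hx))
  · exact ha.abs_diffQuot_le hf hr (fun x hx => hd x (hsub y hy hx)) (hw.mono (hsub y hy)) he he1 hs
      hsr fun x hx => hm x (hsub y hy hx)
  · field_simp

theorem EllipticCoeff.abs_fderiv_sub_fderiv_le (ha : EllipticCoeff δ Λ a) (hf : LipschitzWith K f)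
    (hr : 0 < r) (hd : ∀ x ∈ ball x₀ (4 * r), DifferentiableAt ℝ f x)
    (hw : WeakEq a N (ball x₀ (4 * r)) f fun _ => 0) (he : e N = 0) (he1 : ‖e‖ ≤ 1)
    (hm : ∀ x ∈ ball x₀ (4 * r), |f x| ≤ m) (hh : 0 < h) (hhr : h < r) :
    |fderiv ℝ f (x₀ + h • e) e - fderiv ℝ f x₀ e| ≤ tangentialConst n δ Λ ^ 2 * m / r ^ 2 * h := by
  have hmem : x₀ + h • e ∈ ball x₀ (4 * r) := by
    rw [mem_ball, dist_eq_norm, add_sub_cancel_left, norm_smul, Real.norm_of_nonneg hh.le]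
    nlinarith
  have hlim : Tendsto (fun s => diffQuot f e s (x₀ + h • e) - diffQuot f e s x₀) (𝓝[>] 0)
      (𝓝 (fderiv ℝ f (x₀ + h • e) e - fderiv ℝ f x₀ e)) :=
    (tendsto_diffQuot (hd _ hmem)).sub (tendsto_diffQuot (hd x₀ (mem_ball_self (by linarith))))
  refine le_of_tendsto hlim.abs ?_
  filter_upwards [Ioo_mem_nhdsGT hr] with s hs
  have := ha.abs_diffQuot_diffQuot_le hf hr hd hw he he1 hm hs.1 hs.2 hh hhr
  have h1 : diffQuot f e s (x₀ + h • e) - diffQuot f e s x₀ =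
      h * diffQuot (diffQuot f e s) e h x₀ := by
    rw [diffQuot.eq_1 (diffQuot f e s), mul_inv_cancel_left₀ hh.ne']
    ring
  rw [h1, abs_mul, abs_of_pos hh, mul_comm]
  gcongr

theorem EllipticCoeff.abs_taylor_le (ha : EllipticCoeff δ Λ a) (hf : LipschitzWith K f)
    (hr : 0 < r) (hd : ∀ x ∈ ball x₀ (4 * r), DifferentiableAt ℝ f x)
    (hw : WeakEq a N (ball x₀ (4 * r)) f fun _ => 0)
    (hm : ∀ x ∈ ball x₀ (4 * r), |f x| ≤ m) {y : EuclideanSpace ℝ (Fin n)} (hy : y N = 0)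
    (hyr : ‖y‖ < r) : |f (x₀ + y) - f x₀ - fderiv ℝ f x₀ y| ≤
      tangentialConst n δ Λ ^ 2 * m / r ^ 2 * ‖y‖ ^ 2 := by
  rcases eq_or_ne y 0 with rfl | hy0
  · simp
  have hpos : 0 < ‖y‖ := norm_pos_iff.2 hy0
  have hm0 : 0 ≤ m := (abs_nonneg _).trans (hm x₀ (mem_ball_self (by linarith)))
  set e := ‖y‖⁻¹ • y with he
  have hye : y = ‖y‖ • e := by rw [he, smul_inv_smul₀ hpos.ne']
  have he1 : ‖e‖ = 1 := norm_smul_inv_norm hy0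
  have heN : e N = 0 := by simp [he, hy]
  have hderiv : ∀ t ∈ Icc 0 ‖y‖,
      HasDerivAt (fun t : ℝ => f (x₀ + t • e)) (fderiv ℝ f (x₀ + t • e) e) t := by
    intro t ht
    have h1 : HasDerivAt (fun t : ℝ => x₀ + t • e) e t := by
      simpa using ((hasDerivAt_id t).smul_const e).const_add x₀
    refine (hd _ ?_).hasFDerivAt.comp_hasDerivAt t h1
    rw [mem_ball, dist_eq_norm, add_sub_cancel_left, norm_smul, Real.norm_of_nonneg ht.1, he1]
    linarith [ht.2]
  obtain ⟨t, ht, hte⟩ := exists_hasDerivAt_eq_slope (fun t : ℝ => f (x₀ + t • e))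
    (fun t => fderiv ℝ f (x₀ + t • e) e) hpos
    (fun t ht => (hderiv t ht).continuousAt.continuousWithinAt)
    fun t ht => hderiv t (Ioo_subset_Icc_self ht)
  have h2 : f (x₀ + y) - f x₀ = ‖y‖ * fderiv ℝ f (x₀ + t • e) e := by
    rw [hte, ← hye, zero_smul, add_zero, sub_zero, mul_div_cancel₀ _ hpos.ne']
  have h3 : fderiv ℝ f x₀ y = ‖y‖ * fderiv ℝ f x₀ e := by
    conv_lhs => rw [hye, map_smul, smul_eq_mul]
  have h4 := ha.abs_fderiv_sub_fderiv_le hf hr hd hw heN he1.le hm ht.1 (ht.2.trans hyr)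
  rw [h2, h3, ← mul_sub, abs_mul, abs_norm]
  calc ‖y‖ * |fderiv ℝ f (x₀ + t • e) e - fderiv ℝ f x₀ e|
      ≤ ‖y‖ * (tangentialConst n δ Λ ^ 2 * m / r ^ 2 * ‖y‖) := by
        refine mul_le_mul_of_nonneg_left (h4.trans ?_) hpos.le
        exact mul_le_mul_of_nonneg_left ht.2.le (by positivity)
    _ = _ := by ring

/-- The coefficient of `harmonicSq` in the barrier for the normal derivative. -/
noncomputable def barrierConst (n : ℕ) (δ Λ : ℝ) : ℝ :=
  tangentialConst n δ Λ ^ 2 * distConst n δ Λ +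
    2 * distConst n δ Λ * (2 + n * tangentialConst n δ Λ)

theorem barrierConst_nonneg (n : ℕ) (δ Λ : ℝ) : 0 ≤ barrierConst n δ Λ := by
  have := tangentialConst_nonneg n δ Λ
  have := (distConst_pos n δ Λ).le
  unfold barrierConst
  positivity

/-- The tangential part of the differential of `f` at `x₀`. -/
noncomputable def tangentialCoeff (f : EuclideanSpace ℝ (Fin n) → ℝ) (N : Fin n)
    (x₀ : EuclideanSpace ℝ (Fin n)) (k : Fin n) : ℝ :=
  if k = N then 0 else fderiv ℝ f x₀ (EuclideanSpace.single k 1)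

theorem EllipticCoeff.abs_tangentialCoeff_le (ha : EllipticCoeff δ Λ a) (hf : LipschitzWith K f)
    (hr : 0 < r) (hd : ∀ x ∈ ball x₀ (4 * r), DifferentiableAt ℝ f x)
    (hw : WeakEq a N (ball x₀ (4 * r)) f fun _ => 0) (hm : ∀ x ∈ ball x₀ (4 * r), |f x| ≤ m)
    (k : Fin n) : |tangentialCoeff f N x₀ k| ≤ tangentialConst n δ Λ * m / r := by
  have hsub : ball x₀ (2 * r) ⊆ ball x₀ (4 * r) := ball_subset_ball (by linarith)
  have hm0 : 0 ≤ m := (abs_nonneg _).trans (hm x₀ (mem_ball_self (by linarith)))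
  have := tangentialConst_nonneg n δ Λ
  unfold tangentialCoeff
  split_ifs with hk
  · rw [abs_zero]
    positivity
  · exact ha.abs_fderiv_le hf hr (fun x hx => hd x (hsub hx)) (hw.mono hsub)
      (by simp [Ne.symm hk]) (by simp) fun x hx => hm x (hsub hx)

theorem EllipticCoeff.sub_le_barrier (ha : EllipticCoeff δ Λ a) (hf : LipschitzWith K f)
    (hr : 0 < r) (hd : ∀ x ∈ ball x₀ (4 * r), DifferentiableAt ℝ f x)
    (hw : WeakEq a N (ball x₀ (4 * r)) f fun _ => 0) (hm : ∀ x ∈ ball x₀ (4 * r), |f x| ≤ m)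
    {x : EuclideanSpace ℝ (Fin n)} (hx : harmonicSq a N x₀ x < r ^ 2 / (2 * distConst n δ Λ))
    (hxN : x₀ N < x N) :
    f x - f x₀ ≤ ∑ k, tangentialCoeff f N x₀ k * harmonicCoord a N x₀ k x +
      barrierConst n δ Λ * m / r ^ 2 * harmonicSq a N x₀ x +
      barrierConst n δ Λ * m / r * energyConst n δ Λ * Λ * harmonicCoord a N x₀ N x := by
  have hB := distConst_pos n δ Λ
  have hc := ha.energyConst_nonneg N
  have hΛ := ha.bound_pos N
  have hT := tangentialConst_nonneg n δ Λ
  have hM := barrierConst_nonneg n δ Λ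
  have hm0 : 0 ≤ m := (abs_nonneg _).trans (hm x₀ (mem_ball_self (by linarith)))
  have hl := ha.abs_tangentialCoeff_le hf hr hd hw hm
  set R := r ^ 2 / (2 * distConst n δ Λ) with hR
  have hR0 : 0 < R := by positivity
  have hRr : R ≤ r ^ 2 := by
    refine div_le_self (sq_nonneg r) ?_
    have : 0 ≤ n * (2 * (Λ + (1 + Λ) / δ * Λ) ^ 2) := by positivity
    unfold distConst
    linarith
  set M := barrierConst n δ Λ * m / r ^ 2 with hMdef
  have hM0 : 0 ≤ M := by positivity
  set c := energyConst n δ Λ with hcdef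
  set l := tangentialCoeff f N x₀ with hldef
  set q := harmonicSq a N x₀ with hq
  set H := harmonicCoord a N x₀ with hH
  have hql : LocallyLipschitz q := ha.locallyLipschitz_harmonicSq x₀
  have hHl : ∀ k, LocallyLipschitz (H k) := fun k => ha.locallyLipschitz_harmonicCoord x₀ k
  have hHw : ∀ k, WeakEq a N (ball x₀ (4 * r)) (H k) fun _ => 0 := fun k =>
    (ha.weakEq_harmonicCoord x₀ k).mono (subset_univ _)
  have hH2w : WeakEq a N (ball x₀ (4 * r)) (fun x => H N x ^ 2)
      fun x => 2 * harmonicEnergy a N x₀ N x :=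
    (ha.weakEq_harmonicCoord_sq x₀ N).mono (subset_univ _)
  have hH2l : LocallyLipschitz fun x => H N x ^ 2 := by
    simp only [pow_two]
    exact (hHl N).real_mul (hHl N)
  have hqw : WeakEq a N (ball x₀ (4 * r)) q fun x => ∑ k, 2 * harmonicEnergy a N x₀ k x :=
    (ha.weakEq_harmonicSq x₀).mono (subset_univ _)
  set G := fun x => ∑ k, 2 * harmonicEnergy a N x₀ k x with hG
  have hGb : IsLocBounded G := ha.isLocBounded_sum_harmonicEnergy x₀
  have h1 := hw.add ha (weakEq_const (-f x₀)) hf.locallyLipschitz (.const _) (.const 0) (.const 0)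
  have hl1 := hf.locallyLipschitz.add (.const (-f x₀))
  have h2 := WeakEq.finset_sum ha Finset.univ (fun k _ => (hHw k).const_mul (-l k) (hHl k))
    (fun k _ => (hHl k).real_const_mul (-l k)) fun k _ => (IsLocBounded.const 0).const_mul (-l k)
  have hl2 := LocallyLipschitz.finset_sum Finset.univ fun k _ => (hHl k).real_const_mul (-l k)
  have h3 := (h1.add ha h2 hl1 hl2 ((IsLocBounded.const 0).add (.const 0))
    (.finset_sum Finset.univ fun k _ => (IsLocBounded.const 0).const_mul (-l k))).congr_right
      (g₂ := fun _ => 0) fun x => by simp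
  have h4 := (hqw.const_mul (-M) hql).add ha (hH2w.const_mul (M * (c * Λ)) hH2l)
    (hql.real_const_mul _) (hH2l.real_const_mul _) (hGb.const_mul _)
    (((ha.isLocBounded_harmonicEnergy x₀ N).const_mul 2).const_mul _)
  have hl4 := (hql.real_const_mul (-M)).add (hH2l.real_const_mul (M * (c * Λ)))
  have h5 := h4.add ha ((hHw N).const_mul (-(M * (c * Λ) * r)) (hHl N)) hl4
    ((hHl N).real_const_mul _) ((hGb.const_mul _).add
      (((ha.isLocBounded_harmonicEnergy x₀ N).const_mul 2).const_mul _))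
    ((IsLocBounded.const 0).const_mul _)
  have hl5 := hl4.add ((hHl N).real_const_mul (-(M * (c * Λ) * r)))
  have h6 := h3.add ha h5 (hl1.add hl2) hl5 (.const 0) (((hGb.const_mul _).add
      (((ha.isLocBounded_harmonicEnergy x₀ N).const_mul 2).const_mul _)).add
      ((IsLocBounded.const 0).const_mul _))
  have hcont : Continuous fun x : EuclideanSpace ℝ (Fin n) => x N := by fun_prop
  have hle : ∀ x, q x ≤ R → x ∈ ball x₀ r := fun x hx => ha.dist_lt_of_harmonicSq_le hr hx
  have hsub : ball x₀ r ⊆ ball x₀ (4 * r) := ball_subset_ball (by linarith)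
  have hΩ : IsOpen {x | q x < R ∧ x₀ N < x N} :=
    (isOpen_lt hql.continuous continuous_const).inter (isOpen_lt continuous_const hcont)
  have hcl : closure {x | q x < R ∧ x₀ N < x N} ⊆ {x | q x ≤ R ∧ x₀ N ≤ x N} :=
    closure_minimal (fun x hx => ⟨hx.1.le, hx.2.le⟩)
      ((isClosed_le hql.continuous continuous_const).inter (isClosed_le continuous_const hcont))
  have key := h6.nonpos_of_frontier ha (Ω := {x | q x < R ∧ x₀ N < x N})
    ((hl1.add hl2).add hl5) hqw hGb hΩ
    ((isCompact_closedBall x₀ r).of_isClosed_subset isClosed_closure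
      fun x hx => ball_subset_closedBall (hle x (hcl hx).1))
    (fun x hx => hsub (hle x (hcl hx).1)) ?_
    ((ha.ae_sum_harmonicEnergy_pos x₀).mono fun x hx _ => hx) ?_ x ⟨hx, hxN⟩
  · have hMr : barrierConst n δ Λ * m / r = M * r := by
      rw [hMdef]
      field_simp
    have : 0 ≤ M * (c * Λ) * H N x ^ 2 := by positivity
    simp only [neg_mul, Finset.sum_neg_distrib] at key
    rw [hMr]
    linarith
  · filter_upwards [ha.ae_harmonicEnergy_last (N := N) x₀] with y hy _
    have h7 : G y ≤ c := ha.sum_harmonicEnergy_le x₀ y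
    have h8 : 1 ≤ Λ * harmonicEnergy a N x₀ N y := by
      rw [← inv_le_iff_one_le_mul₀' hΛ]
      exact hy
    have h9 : M * c ≤ M * c * (Λ * harmonicEnergy a N x₀ N y) :=
      le_mul_of_one_le_right (by positivity) h8
    nlinarith [mul_le_mul_of_nonneg_left h7 hM0, mul_nonneg hM0 hc]
  · intro y hy
    rw [frontier, hΩ.interior_eq] at hy
    obtain ⟨hyR, hyN⟩ := hcl hy.1
    have hyr := hle y hyR
    have hHN : 0 ≤ H N y := ha.harmonicCoord_last_nonneg hyN
    have hHq : ∀ k, H k y ^ 2 ≤ q y := fun k =>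
      Finset.single_le_sum (f := fun k => harmonicCoord a N x₀ k y ^ 2) (fun _ _ => sq_nonneg _)
        (Finset.mem_univ k)
    have hHr : ∀ k, |H k y| ≤ r := fun k =>
      abs_le_of_sq_le_sq ((hHq k).trans (hyR.trans hRr)) hr.le
    have h7 : M * (c * Λ) * (H N y ^ 2 - r * H N y) ≤ 0 := by
      refine mul_nonpos_of_nonneg_of_nonpos (by positivity) ?_
      nlinarith [(le_abs_self _).trans (hHr N)]
    have h8 : f y - f x₀ - ∑ k, l k * H k y ≤ M * q y := by
      by_cases hyR' : q y < R
      · have hyN' : y N = x₀ N := le_antisymm (not_lt.1 fun h => hy.2 ⟨hyR', h⟩) hyN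
        have hT := ha.abs_taylor_le hf hr hd hw hm (y := y - x₀) (by simp [hyN'])
          (by rwa [← dist_eq_norm])
        have h9 : fderiv ℝ f x₀ (y - x₀) = ∑ k, l k * H k y := by
          conv_lhs => rw [← (EuclideanSpace.basisFun (Fin n) ℝ).sum_repr (y - x₀)]
          rw [map_sum]
          refine Finset.sum_congr rfl fun k _ => ?_
          rw [hH, harmonicCoord_of_eq hyN']
          by_cases hk : k = N
          · simp [hk, hyN']
          · simp [hldef, tangentialCoeff, hk, mul_comm]
        rw [add_sub_cancel, h9, ← dist_eq_norm] at hT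
        refine (le_abs_self _).trans (hT.trans ?_)
        have h10 : dist y x₀ ^ 2 ≤ distConst n δ Λ * q y := ha.dist_sq_le_harmonicSq x₀ y
        calc tangentialConst n δ Λ ^ 2 * m / r ^ 2 * dist y x₀ ^ 2
            ≤ tangentialConst n δ Λ ^ 2 * m / r ^ 2 * (distConst n δ Λ * q y) := by gcongr
          _ = (tangentialConst n δ Λ ^ 2 * distConst n δ Λ) * m / r ^ 2 * q y := by ring
          _ ≤ M * q y := by
            have : 0 ≤ q y := (sq_nonneg _).trans (hHq N)
            rw [hMdef, barrierConst]
            gcongr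
            exact le_add_of_nonneg_right (by positivity)
      · have hyR' : q y = R := le_antisymm hyR (not_lt.1 hyR')
        have h9 : -∑ k, l k * H k y ≤ n * tangentialConst n δ Λ * m := by
          refine (neg_le_abs _).trans ((Finset.abs_sum_le_sum_abs _ _).trans ?_)
          refine (Finset.sum_le_sum (g := fun _ => tangentialConst n δ Λ * m) fun k _ => ?_).trans_eq
            (by simp; ring)
          rw [abs_mul]
          calc |l k| * |H k y| ≤ tangentialConst n δ Λ * m / r * r :=
                mul_le_mul (hl k) (hHr k) (abs_nonneg _) (by positivity)
            _ = _ := by field_simp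
        have h10 := abs_le.1 (hm y (hsub hyr))
        have h11 := abs_le.1 (hm x₀ (mem_ball_self (by linarith)))
        have h12 : (2 + n * tangentialConst n δ Λ) * m ≤ M * R := by
          have : M * R = (tangentialConst n δ Λ ^ 2 / 2 +
              (2 + n * tangentialConst n δ Λ)) * m := by
            rw [hMdef, hR, barrierConst]
            field_simp
          rw [this]
          have : 0 ≤ tangentialConst n δ Λ ^ 2 / 2 * m := by positivity
          linarith
        rw [hyR']
        linarith
    simp only [neg_mul, Finset.sum_neg_distrib]
    linarith

/-- The constant of the one-sided estimate of the normal derivative. -/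
noncomputable def normalConst (n : ℕ) (δ Λ : ℝ) : ℝ :=
  n * tangentialConst n δ Λ * (1 + (1 + Λ) / δ) +
    barrierConst n δ Λ * energyConst n δ Λ * Λ * (1 + (1 + Λ) / δ)

theorem EllipticCoeff.fderiv_single_le (ha : EllipticCoeff δ Λ a) (hf : LipschitzWith K f)
    (hr : 0 < r) (hd : ∀ x ∈ ball x₀ (4 * r), DifferentiableAt ℝ f x)
    (hw : WeakEq a N (ball x₀ (4 * r)) f fun _ => 0) (hm : ∀ x ∈ ball x₀ (4 * r), |f x| ≤ m) :
    fderiv ℝ f x₀ (EuclideanSpace.single N 1) ≤ normalConst n δ Λ * m / r := by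
  have hB := distConst_pos n δ Λ
  have hc := ha.energyConst_nonneg N
  have hΛ := ha.bound_pos N
  have hδ := ha.delta_pos
  have hT := tangentialConst_nonneg n δ Λ
  have hM := barrierConst_nonneg n δ Λ
  have hm0 : 0 ≤ m := (abs_nonneg _).trans (hm x₀ (mem_ball_self (by linarith)))
  have hl := ha.abs_tangentialCoeff_le hf hr hd hw hm
  set A := 1 + (1 + Λ) / δ with hA
  have hA0 : 0 ≤ A := by positivity
  set e : EuclideanSpace ℝ (Fin n) := EuclideanSpace.single N 1 with he
  have hdist : ∀ s : ℝ, 0 < s → dist (x₀ + s • e) x₀ = s := fun s hs => by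
    rw [dist_eq_norm, add_sub_cancel_left, norm_smul, Real.norm_of_nonneg hs.le, he]
    simp
  have hH : ∀ k s, 0 < s → |harmonicCoord a N x₀ k (x₀ + s • e)| ≤ A * s := fun k s hs => by
    have := (ha.lipschitzWith_harmonicCoord (N := N) x₀ k).dist_le_mul (x₀ + s • e) x₀
    rwa [hdist s hs, Real.coe_toNNReal _ hA0, Real.dist_eq, harmonicCoord_self, sub_zero] at this
  have hq : ∀ s, 0 < s → harmonicSq a N x₀ (x₀ + s • e) ≤ n * A ^ 2 * s ^ 2 := fun s hs => by
    simpa [hdist s hs] using ha.harmonicSq_le_dist_sq x₀ (x₀ + s • e)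
  have hlim := tendsto_diffQuot (e := e) (hd x₀ (mem_ball_self (by linarith)))
  have hlim' : Filter.Tendsto (fun s : ℝ => normalConst n δ Λ * m / r +
      barrierConst n δ Λ * m / r ^ 2 * (n * A ^ 2) * s) (nhdsWithin 0 (Ioi 0))
      (nhds (normalConst n δ Λ * m / r)) := by
    refine Filter.Tendsto.mono_left ?_ nhdsWithin_le_nhds
    refine Continuous.tendsto' (by fun_prop) _ _ (by simp)
  refine le_of_tendsto_of_tendsto hlim hlim' ?_
  have hsmall : ∀ᶠ s : ℝ in nhdsWithin 0 (Ioi 0),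
      n * A ^ 2 * s ^ 2 < r ^ 2 / (2 * distConst n δ Λ) := by
    have : Filter.Tendsto (fun s : ℝ => n * A ^ 2 * s ^ 2) (nhdsWithin 0 (Ioi 0)) (nhds 0) :=
      (Continuous.tendsto' (by fun_prop) _ _ (by simp)).mono_left nhdsWithin_le_nhds
    exact this.eventually_lt_const (by positivity)
  filter_upwards [hsmall, self_mem_nhdsWithin] with s hs hs0
  have hs0 : 0 < s := hs0
  have key := ha.sub_le_barrier hf hr hd hw hm ((hq s hs0).trans_lt hs) (by simp [he, hs0])
  have h1 : ∑ k, tangentialCoeff f N x₀ k * harmonicCoord a N x₀ k (x₀ + s • e) ≤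
      n * tangentialConst n δ Λ * A * (m / r) * s := by
    refine (Finset.sum_le_sum (g := fun _ => tangentialConst n δ Λ * m / r * (A * s))
      fun k _ => ?_).trans_eq (by simp; ring)
    refine (le_abs_self _).trans ?_
    rw [abs_mul]
    exact mul_le_mul (hl k) (hH k s hs0) (abs_nonneg _) (by positivity)
  have h2 := mul_le_mul_of_nonneg_left (hq s hs0)
    (show 0 ≤ barrierConst n δ Λ * m / r ^ 2 by positivity)
  have h3 := mul_le_mul_of_nonneg_left ((le_abs_self _).trans (hH N s hs0))
    (show 0 ≤ barrierConst n δ Λ * m / r * energyConst n δ Λ * Λ by positivity)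
  rw [diffQuot, inv_mul_le_iff₀ hs0, normalConst, ← hA]
  calc f (x₀ + s • e) + -1 * f x₀ = f (x₀ + s • e) - f x₀ := by ring
    _ ≤ _ := key
    _ ≤ _ := add_le_add (add_le_add h1 h2) h3
    _ = _ := by ring

/-- The constant of the interior gradient estimate. -/
noncomputable def gradConst (n : ℕ) (δ Λ : ℝ) : ℝ :=
  n * (tangentialConst n δ Λ + |normalConst n δ Λ|)

theorem gradConst_nonneg (n : ℕ) (δ Λ : ℝ) : 0 ≤ gradConst n δ Λ := by
  have := tangentialConst_nonneg n δ Λ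
  unfold gradConst
  positivity

theorem EllipticCoeff.norm_fderiv_le (ha : EllipticCoeff δ Λ a) (hf : LipschitzWith K f)
    (hr : 0 < r) (hd : ∀ x ∈ ball x₀ (4 * r), DifferentiableAt ℝ f x)
    (hw : WeakEq a N (ball x₀ (4 * r)) f fun _ => 0) (hm : ∀ x ∈ ball x₀ (4 * r), |f x| ≤ m) :
    ‖fderiv ℝ f x₀‖ ≤ gradConst n δ Λ * m / r := by
  have hT := tangentialConst_nonneg n δ Λ
  have hG := gradConst_nonneg n δ Λ
  have hm0 : 0 ≤ m := (abs_nonneg _).trans (hm x₀ (mem_ball_self (by linarith)))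
  have hsub : ball x₀ (2 * r) ⊆ ball x₀ (4 * r) := ball_subset_ball (by linarith)
  have hneg := ha.fderiv_single_le (f := fun x => (-1) * f x) (K := K)
    (by simp only [neg_one_mul]; exact hf.neg) hr (fun x hx => (hd x hx).const_mul _)
    ((hw.const_mul (-1) hf.locallyLipschitz).congr_right fun x => by simp)
    (fun x hx => by simpa using hm x hx)
  have hpos := ha.fderiv_single_le hf hr hd hw hm
  have hcomp : ∀ k, |fderiv ℝ f x₀ (EuclideanSpace.single k 1)| ≤
      (tangentialConst n δ Λ + |normalConst n δ Λ|) * m / r := by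
    intro k
    by_cases hk : k = N
    · subst hk
      rw [fderiv_const_mul (hd x₀ (mem_ball_self (by linarith)))] at hneg
      have : normalConst n δ Λ * m / r ≤
          (tangentialConst n δ Λ + |normalConst n δ Λ|) * m / r := by
        gcongr
        linarith [le_abs_self (normalConst n δ Λ)]
      refine abs_le.2 ⟨?_, by linarith⟩
      simp at hneg
      linarith
    · refine (ha.abs_fderiv_le hf hr (fun x hx => hd x (hsub hx)) (hw.mono hsub)
        (by simp [Ne.symm hk]) (by simp) fun x hx => hm x (hsub hx)).trans ?_
      gcongr
      linarith [abs_nonneg (normalConst n δ Λ)]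
  refine ContinuousLinearMap.opNorm_le_bound _ (by positivity) fun v => ?_
  conv_lhs => rw [← (EuclideanSpace.basisFun (Fin n) ℝ).sum_repr v]
  rw [map_sum]
  refine (norm_sum_le _ _).trans ((Finset.sum_le_sum (g := fun _ =>
    (tangentialConst n δ Λ + |normalConst n δ Λ|) * m / r * ‖v‖) fun k _ => ?_).trans_eq ?_)
  · rw [map_smul, norm_smul, mul_comm]
    refine mul_le_mul ?_ ?_ (norm_nonneg _) (by positivity)
    · simpa using hcomp k
    · simpa using PiLp.norm_apply_le v k
  · simp [gradConst]
    ring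

end NormalEstimate

section IntegralEstimate

variable {n : ℕ} {a : ℝ → Matrix (Fin n) (Fin n) ℝ} {N : Fin n} {δ Λ p : ℝ} {K : NNReal}
  {f : EuclideanSpace ℝ (Fin n) → ℝ}

/-- The relative radius on which a solution keeps half of its value at a weighted maximum. -/
noncomputable def radiusRatio (n : ℕ) (δ Λ p : ℝ) : ℝ :=
  (4 + 32 * gradConst n δ Λ * 2 ^ (n / p))⁻¹

theorem radiusRatio_pos (n : ℕ) (δ Λ p : ℝ) : 0 < radiusRatio n δ Λ p := by
  have := gradConst_nonneg n δ Λ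
  unfold radiusRatio
  positivity

/-- The constant of the weighted supremum estimate by the `L^p` norm. -/
noncomputable def supConst (n : ℕ) (δ Λ p : ℝ) : ℝ :=
  2 * ((radiusRatio n δ Λ p ^ n * volume.real (ball (0 : EuclideanSpace ℝ (Fin n)) 1))⁻¹) ^ (1 / p)

theorem supConst_nonneg (n : ℕ) (δ Λ p : ℝ) : 0 ≤ supConst n δ Λ p := by
  have := radiusRatio_pos n δ Λ p
  unfold supConst
  positivity

theorem EllipticCoeff.half_abs_le (ha : EllipticCoeff δ Λ a) (hf : LipschitzWith K f)
    {x y : EuclideanSpace ℝ (Fin n)} {d : ℝ} (hd0 : 0 < d)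
    (hd : ∀ z ∈ ball x d, DifferentiableAt ℝ f z)
    (hw : WeakEq a N (ball x d) f fun _ => 0)
    (hm : ∀ z ∈ ball x (d / 2), |f z| ≤ 2 ^ (n / p) * |f x|)
    (hy : y ∈ ball x (radiusRatio n δ Λ p * d)) : |f x| / 2 ≤ |f y| := by
  have hG := gradConst_nonneg n δ Λ
  have hθ := radiusRatio_pos n δ Λ p
  set θ := radiusRatio n δ Λ p with hθdef
  have hθ4 : θ ≤ 1 / 4 := by
    rw [hθdef, radiusRatio, one_div]
    refine inv_anti₀ (by norm_num) ?_
    have : 0 ≤ 32 * gradConst n δ Λ * 2 ^ (n / p) := by positivity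
    linarith
  have hθ' : 32 * gradConst n δ Λ * 2 ^ (n / p) * θ ≤ 1 := by
    rw [hθdef, radiusRatio, ← div_eq_mul_inv]
    refine (div_le_one (by positivity)).2 (by linarith)
  have hgrad : ∀ z ∈ ball x (θ * d),
      ‖fderiv ℝ f z‖ ≤ gradConst n δ Λ * (2 ^ (n / p) * |f x|) / (d / 16) := by
    intro z hz
    have hz' : dist z x < d / 4 := (mem_ball.1 hz).trans_le (by nlinarith)
    have hsub : ball z (4 * (d / 16)) ⊆ ball x (d / 2) := ball_subset_ball' (by linarith)
    have hsub' : ball x (d / 2) ⊆ ball x d := ball_subset_ball (by linarith)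
    exact ha.norm_fderiv_le hf (by positivity) (fun w hw => hd w (hsub' (hsub hw)))
      (hw.mono (hsub.trans hsub')) fun w hw => hm w (hsub hw)
  have hsub : ball x (θ * d) ⊆ ball x d := ball_subset_ball (by nlinarith)
  have hlip := (convex_ball x (θ * d)).norm_image_sub_le_of_norm_fderiv_le
    (fun z hz => hd z (hsub hz)) hgrad (mem_ball_self (by positivity)) hy
  have hdist : ‖y - x‖ ≤ θ * d := by
    rw [← dist_eq_norm]
    exact (mem_ball.1 hy).le
  have h1 : |f y - f x| ≤ |f x| / 2 := by
    calc |f y - f x| ≤ gradConst n δ Λ * (2 ^ (n / p) * |f x|) / (d / 16) * ‖y - x‖ := hlip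
      _ ≤ gradConst n δ Λ * (2 ^ (n / p) * |f x|) / (d / 16) * (θ * d) := by gcongr
      _ = (32 * gradConst n δ Λ * 2 ^ (n / p) * θ) * (|f x| / 2) := by
        field_simp
        ring
      _ ≤ |f x| / 2 := mul_le_of_le_one_left (by positivity) hθ'
  have h2 := abs_sub_abs_le_abs_sub (f x) (f y)
  rw [abs_sub_comm] at h2
  linarith

theorem EllipticCoeff.weighted_abs_le (ha : EllipticCoeff δ Λ a) (hf : LipschitzWith K f)
    (hp : 0 < p) (hd : ∀ z ∈ ball 0 1, DifferentiableAt ℝ f z)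
    (hw : WeakEq a N (ball 0 1) f fun _ => 0) {x : EuclideanSpace ℝ (Fin n)}
    (hx : x ∈ closedBall 0 1) :
    (1 - ‖x‖) ^ (n / p) * |f x| ≤
      supConst n δ Λ p * (∫ y in ball 0 1, |f y| ^ p) ^ (1 / p) := by
  have hn : 0 < n := N.pos
  have hθ := radiusRatio_pos n δ Λ p
  have hα : 0 < n / p := by positivity
  have hint0 : 0 ≤ ∫ y in ball (0 : EuclideanSpace ℝ (Fin n)) 1, |f y| ^ p :=
    integral_nonneg fun y => by positivity
  have hcont : Continuous fun x => (1 - ‖x‖) ^ (n / p) * |f x| :=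
    ((continuous_const.sub continuous_norm).rpow_const fun _ => .inr hα.le).mul
      hf.continuous.abs
  obtain ⟨z, hz, hmax⟩ := (isCompact_closedBall (0 : EuclideanSpace ℝ (Fin n)) 1).exists_isMaxOn
    ⟨x, hx⟩ hcont.continuousOn
  refine (hmax hx).trans ?_
  rw [mem_closedBall_zero_iff] at hz
  set d := 1 - ‖z‖ with hddef
  rcases (sub_nonneg.2 hz).eq_or_lt with hd0 | hd0
  · have : (1 - ‖z‖) ^ (n / p) * |f z| = 0 := by
      rw [← hd0, Real.zero_rpow hα.ne', zero_mul]
    refine this.trans_le ?_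
    have := supConst_nonneg n δ Λ p
    positivity
  change 0 < d at hd0
  have hsub : ball z d ⊆ ball 0 1 := ball_subset_ball' (by rw [dist_zero_right]; linarith)
  have hm : ∀ w ∈ ball z (d / 2), |f w| ≤ 2 ^ (n / p) * |f z| := by
    intro w hw
    have hw1 : ‖w‖ ≤ ‖z‖ + d / 2 := by
      have := mem_ball_iff_norm.1 hw
      linarith [norm_le_norm_add_norm_sub z w, norm_sub_rev z w]
    have hw2 : d / 2 ≤ 1 - ‖w‖ := by linarith
    have h1 : (1 - ‖w‖) ^ (n / p) * |f w| ≤ d ^ (n / p) * |f z| :=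
      hmax (mem_closedBall_zero_iff.2 (by linarith))
    have h2 : (d / 2) ^ (n / p) * |f w| ≤ d ^ (n / p) * |f z| := by
      refine le_trans ?_ h1
      gcongr
    rw [Real.div_rpow hd0.le zero_le_two, div_mul_eq_mul_div, div_le_iff₀ (by positivity),
      mul_assoc] at h2
    rw [mul_comm]
    exact le_of_mul_le_mul_left h2 (by positivity)
  have hhalf : ∀ y ∈ ball z (radiusRatio n δ Λ p * d), |f z| / 2 ≤ |f y| := fun y hy =>
    ha.half_abs_le hf hd0 (fun w hw => hd w (hsub hw)) (hw.mono hsub) hm hy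
  have hsub' : ball z (radiusRatio n δ Λ p * d) ⊆ ball 0 1 := by
    refine (ball_subset_ball ?_).trans hsub
    have hG := gradConst_nonneg n δ Λ
    refine mul_le_of_le_one_left hd0.le (inv_le_one_of_one_le₀ ?_)
    have : 0 ≤ 32 * gradConst n δ Λ * 2 ^ (n / p) := by positivity
    linarith
  have hfp : IntegrableOn (fun y => |f y| ^ p) (ball 0 1) :=
    (((hf.continuous.abs.rpow_const fun _ => .inr hp.le).continuousOn).integrableOn_compact
      (isCompact_closedBall 0 1)).mono_set ball_subset_closedBall
  have hvol : volume.real (ball z (radiusRatio n δ Λ p * d)) =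
      radiusRatio n δ Λ p ^ n * volume.real (ball (0 : EuclideanSpace ℝ (Fin n)) 1) * d ^ n := by
    rw [measureReal_def, Measure.addHaar_ball_of_pos _ _ (by positivity), finrank_euclideanSpace_fin,
      ENNReal.toReal_mul, ENNReal.toReal_ofReal (by positivity), measureReal_def, mul_pow]
    ring
  set ω := radiusRatio n δ Λ p ^ n * volume.real (ball (0 : EuclideanSpace ℝ (Fin n)) 1) with hω
  have hω0 : 0 < ω := mul_pos (by positivity)
    (ENNReal.toReal_pos (measure_ball_pos _ _ one_pos).ne' measure_ball_lt_top.ne)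
  have key : ω * d ^ n * (|f z| / 2) ^ p ≤ ∫ y in ball 0 1, |f y| ^ p := by
    calc ω * d ^ n * (|f z| / 2) ^ p
        = ∫ y in ball z (radiusRatio n δ Λ p * d), (|f z| / 2) ^ p := by
          rw [setIntegral_const, hvol, smul_eq_mul]
      _ ≤ ∫ y in ball z (radiusRatio n δ Λ p * d), |f y| ^ p := by
          refine setIntegral_mono_on (by simp [measure_ball_lt_top]) (hfp.mono_set hsub')
            measurableSet_ball fun y hy => ?_
          have := hhalf y hy
          gcongr
      _ ≤ _ := setIntegral_mono_set hfp (ae_of_all _ fun y => by positivity)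
          hsub'.eventuallyLE
  have hpow : (d ^ (n / p) * |f z| / 2) ^ p = d ^ n * (|f z| / 2) ^ p := by
    rw [mul_div_assoc, Real.mul_rpow (by positivity) (by positivity), ← Real.rpow_mul hd0.le,
      div_mul_cancel₀ _ hp.ne', Real.rpow_natCast]
  have h3 : (d ^ (n / p) * |f z| / 2) ^ p ≤ ω⁻¹ * ∫ y in ball 0 1, |f y| ^ p := by
    rw [hpow, le_inv_mul_iff₀ hω0, ← mul_assoc]
    exact key
  have h4 := Real.rpow_le_rpow (by positivity) h3 (one_div_nonneg.2 hp.le)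
  rw [← Real.rpow_mul (by positivity), mul_one_div_cancel hp.ne', Real.rpow_one,
    Real.mul_rpow (by positivity) hint0] at h4
  rw [supConst, ← hω]
  linarith

theorem EllipticCoeff.norm_fderiv_le_integral (ha : EllipticCoeff δ Λ a) (hf : LipschitzWith K f)
    (hp : 0 < p) (hd : ∀ z ∈ ball 0 1, DifferentiableAt ℝ f z)
    (hw : WeakEq a N (ball 0 1) f fun _ => 0) {x : EuclideanSpace ℝ (Fin n)}
    (hx : x ∈ ball 0 (1 / 2)) :
    ‖fderiv ℝ f x‖ ≤ gradConst n δ Λ * 4 ^ (n / p) * supConst n δ Λ p * 16 *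
      (∫ y in ball 0 1, |f y| ^ p) ^ (1 / p) := by
  set I := (∫ y in ball 0 1, |f y| ^ p) ^ (1 / p) with hI
  have hx' := mem_ball_zero_iff.1 hx
  have hsub : ball x (4 * (1 / 16)) ⊆ ball 0 1 :=
    ball_subset_ball' (by rw [dist_zero_right]; linarith)
  refine (ha.norm_fderiv_le (m := 4 ^ (n / p) * (supConst n δ Λ p * I)) hf
    (by norm_num : (0 : ℝ) < 1 / 16) (fun w hw => hd w (hsub hw)) (hw.mono hsub)
    fun y hy => ?_).trans_eq (by rw [div_div_eq_mul_div]; ring)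
  have h1 := ha.weighted_abs_le hf hp hd hw (ball_subset_closedBall (hsub hy))
  have hy1 : ‖y‖ ≤ 3 / 4 := by
    have := mem_ball_iff_norm.1 hy
    linarith [norm_le_norm_add_norm_sub x y, norm_sub_rev x y]
  have h2 : (1 / 4 : ℝ) ^ (n / p) * |f y| ≤ supConst n δ Λ p * I := by
    refine le_trans ?_ h1
    gcongr
    linarith
  rwa [one_div, Real.inv_rpow (by norm_num), inv_mul_le_iff₀ (by positivity)] at h2

end IntegralEstimate

/-- interior Lipschitz estimate for weak solutions of divergence form
equations with coefficients depending only on the last coordinate. -/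
theorem stmt_7 (n : ℕ) (hn : 2 ≤ n) (δ Λ : ℝ) (hδ : δ ∈ Set.Ioo (0 : ℝ) 1) (hΛ : 0 < Λ)
    (p : ℝ) (hp : 0 < p) :
    ∃ C : ℝ, 0 < C ∧
      ∀ abar : ℝ → Matrix (Fin n) (Fin n) ℝ,
        (∀ i j, Measurable fun s => abar s i j) →
        (∀ s, (abar s)ᵀ = abar s) →
        (∀ (s : ℝ) (ξ : Fin n → ℝ), δ * ∑ i, ξ i ^ 2 ≤ ∑ i, ∑ j, abar s i j * ξ i * ξ j) →
        (∀ s i j, |abar s i j| ≤ Λ) →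
        ∀ u : EuclideanSpace ℝ (Fin n) → ℝ,
          (∃ K : NNReal, LipschitzOnWith K u (ball 0 1)) →
          (∀ x ∈ ball (0 : EuclideanSpace ℝ (Fin n)) 1, DifferentiableAt ℝ u x) →
          (∀ φ : EuclideanSpace ℝ (Fin n) → ℝ, ContDiff ℝ (⊤ : ℕ∞) φ → HasCompactSupport φ →
            tsupport φ ⊆ ball 0 1 →
            (∫ x in ball (0 : EuclideanSpace ℝ (Fin n)) 1,
              ∑ i, ∑ j, abar (x (⟨n - 1, by omega⟩ : Fin n)) i j *
                fderiv ℝ u x (EuclideanSpace.single j 1) *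
                fderiv ℝ φ x (EuclideanSpace.single i 1)) = 0) →
          ∀ c : ℝ,
            LipschitzOnWith
              (Real.toNNReal (C * (∫ x in ball (0 : EuclideanSpace ℝ (Fin n)) 1,
                |u x - c| ^ p) ^ (1 / p)))
              u (ball 0 (1 / 2)) := by
  have hG := gradConst_nonneg n δ Λ
  have hS := supConst_nonneg n δ Λ p
  refine ⟨gradConst n δ Λ * 4 ^ (n / p) * supConst n δ Λ p * 16 + 1, by positivity, ?_⟩
  intro abar hmeas hsymm hell hbound u ⟨K, hu⟩ hdiff hweak c
  have ha : EllipticCoeff δ Λ abar :=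
    ⟨hδ.1, hmeas, fun s i j => congrFun (congrFun (hsymm s) j) i, hell, hbound⟩
  obtain ⟨g, hg, hgu⟩ := hu.extend_real
  set f := fun x => g x - c with hfdef
  have hf : LipschitzWith K f := by
    simpa only [hfdef, sub_eq_add_neg, add_zero] using hg.add (LipschitzWith.const (-c))
  have hfu : ∀ x ∈ ball (0 : EuclideanSpace ℝ (Fin n)) 1, f =ᶠ[nhds x] fun x => u x - c := by
    intro x hx
    filter_upwards [isOpen_ball.mem_nhds hx] with y hy
    rw [hfdef, hgu hy]
  have hfd : ∀ x ∈ ball (0 : EuclideanSpace ℝ (Fin n)) 1, fderiv ℝ f x = fderiv ℝ u x :=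
    fun x hx => by rw [(hfu x hx).fderiv_eq, fderiv_sub_const]
  have hd : ∀ x ∈ ball (0 : EuclideanSpace ℝ (Fin n)) 1, DifferentiableAt ℝ f x :=
    fun x hx => (hfu x hx).differentiableAt_iff.2 ((hdiff x hx).sub_const c)
  have hw : WeakEq abar ⟨n - 1, by omega⟩ (ball 0 1) f fun _ => 0 := by
    refine .of_smooth ha isOpen_ball hf.locallyLipschitz fun φ hφ hc hs => ?_
    rw [← hweak φ hφ hc hs, ← setIntegral_eq_integral_of_forall_compl_eq_zero (s := ball 0 1)]
    · refine setIntegral_congr_fun measurableSet_ball fun x hx => ?_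
      simp only [energyForm_apply, hfd x hx]
    · intro x hx
      have : fderiv ℝ φ x = 0 := fderiv_of_notMem_tsupport ℝ fun h => hx (hs h)
      simp [this]
  have hint : ∫ x in ball (0 : EuclideanSpace ℝ (Fin n)) 1, |u x - c| ^ p =
      ∫ x in ball 0 1, |f x| ^ p :=
    setIntegral_congr_fun measurableSet_ball fun x hx => by simp only [(hfu x hx).eq_of_nhds]
  have hsub : ball (0 : EuclideanSpace ℝ (Fin n)) (1 / 2) ⊆ ball 0 1 :=
    ball_subset_ball (by norm_num)
  refine (convex_ball _ _).lipschitzOnWith_of_nnnorm_fderiv_le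
    (fun x hx => hdiff x (hsub hx)) fun x hx => ?_
  rw [← hfd x (hsub hx), hint, ← NNReal.coe_le_coe, coe_nnnorm, Real.coe_toNNReal']
  refine le_max_of_le_left ((ha.norm_fderiv_le_integral hf hp hd hw hx).trans ?_)
  have : 0 ≤ (∫ x in ball (0 : EuclideanSpace ℝ (Fin n)) 1, |f x| ^ p) ^ (1 / p) :=
    Real.rpow_nonneg (integral_nonneg fun y => by positivity) _
  exact mul_le_mul_of_nonneg_right (by linarith) this
end

section
/- Let n ≥ 2 and let ω₀ : [0,1] → [0,∞) be nondecreasing. Let h : ℝ^{n−1} → ℝ be differentiable with |∇h(x') − ∇h(y')| ≤ ω₀(|x' − y'|) whenever |x' − y'| ≤ 1. Fix x₀ = (x₀', x₀ⁿ) ∈ ℝⁿ with ∇h(x₀') = 0. Then there is a constant C depending only on n such that for every r ∈ (0,1], the Lebesgue measure of the set {x = (x', xⁿ) ∈ B_r(x₀) : (xⁿ − h(x'))·(xⁿ − h(x₀')) < 0} is at most C·rⁿ·ω₀(r). -/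
open MeasureTheory Metric Set

/-- Projection of a point of `ℝⁿ` onto its first `n - 1` coordinates. -/
noncomputable def projE (n : ℕ) (x : EuclideanSpace ℝ (Fin n)) :
    EuclideanSpace ℝ (Fin (n - 1)) :=
  (EuclideanSpace.equiv (Fin (n - 1)) ℝ).symm fun i => x (Fin.castLE (Nat.sub_le n 1) i)

theorem EuclideanSpace.volume_setOf_abs_sub_le {ι : Type*} [Fintype ι] (c s : ι → ℝ) :
    volume {x : EuclideanSpace ℝ ι | ∀ i, |x i - c i| ≤ s i} =
      ∏ i, ENNReal.ofReal (2 * s i) := by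
  have hset : {x : EuclideanSpace ℝ ι | ∀ i, |x i - c i| ≤ s i} =
      WithLp.ofLp ⁻¹' Set.Icc (c - s) (c + s) := by
    ext x
    simp only [Set.mem_ofPred_eq, Set.mem_preimage, Set.mem_Icc, Pi.le_def, Pi.sub_apply,
      Pi.add_apply, ← forall_and]
    refine forall_congr' fun i => ?_
    rw [abs_le]
    constructor <;> rintro ⟨h₁, h₂⟩ <;> constructor <;> linarith
  rw [hset, (PiLp.volume_preserving_ofLp ι).measure_preimage measurableSet_Icc.nullMeasurableSet,
    Real.volume_Icc_pi]
  refine Finset.prod_congr rfl fun i _ => ?_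
  simp only [Pi.add_apply, Pi.sub_apply]
  ring_nf

theorem dist_projE_le (n : ℕ) (x y : EuclideanSpace ℝ (Fin n)) :
    dist (projE n x) (projE n y) ≤ dist x y := by
  rw [EuclideanSpace.dist_eq, EuclideanSpace.dist_eq]
  refine Real.sqrt_le_sqrt ?_
  calc ∑ i, dist (projE n x i) (projE n y i) ^ 2
      = ∑ j ∈ Finset.univ.map (Fin.castLEEmb (Nat.sub_le n 1)), dist (x j) (y j) ^ 2 := by
        rw [Finset.sum_map]; rfl
    _ ≤ ∑ j, dist (x j) (y j) ^ 2 :=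
        Finset.sum_le_sum_of_subset_of_nonneg (Finset.subset_univ _) fun _ _ _ => by positivity

/-- A function whose derivative vanishes at `a` and has modulus of continuity `ω` oscillates by at
most `r * ω r` on the ball of radius `r ≤ 1` about `a`. -/
theorem abs_sub_le_of_fderiv_modulus {E : Type*} [NormedAddCommGroup E] [NormedSpace ℝ E]
    {ω : ℝ → ℝ} (hω : MonotoneOn ω (Set.Icc 0 1)) {h : E → ℝ} (hd : Differentiable ℝ h)
    (hmod : ∀ x y, dist x y ≤ 1 → ‖fderiv ℝ h x - fderiv ℝ h y‖ ≤ ω (dist x y))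
    {a : E} (ha : fderiv ℝ h a = 0) {r : ℝ} (hr : r ∈ Set.Ioc (0 : ℝ) 1) {x : E}
    (hx : x ∈ ball a r) : |h x - h a| ≤ r * ω r := by
  have hbound : ∀ y ∈ ball a r, ‖fderiv ℝ h y‖ ≤ ω r := by
    intro y hy
    have hy' : dist y a ≤ r := (mem_ball.1 hy).le
    have h₁ := hmod y a (hy'.trans hr.2)
    rw [ha, sub_zero] at h₁
    exact h₁.trans (hω ⟨dist_nonneg, hy'.trans hr.2⟩ ⟨hr.1.le, hr.2⟩ hy')
  have hmv := (convex_ball a r).norm_image_sub_le_of_norm_fderiv_le (fun y _ => hd y) hbound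
    (mem_ball_self hr.1) hx
  have hω0 : 0 ≤ ω r := (norm_nonneg _).trans (hbound a (mem_ball_self hr.1))
  rw [← Real.norm_eq_abs, mul_comm]
  refine hmv.trans (mul_le_mul_of_nonneg_left ?_ hω0)
  rw [← dist_eq_norm]
  exact (mem_ball.1 hx).le

/-- the measure of the region of `B_r(x₀)` between the graph
`xⁿ = h(x')` and the hyperplane `xⁿ = h(x₀')` is at most `C rⁿ ω₀(r)`. -/
theorem stmt_12 (n : ℕ) (hn : 2 ≤ n) :
    ∃ C : ℝ, 0 < C ∧
      ∀ ω₀ : ℝ → ℝ, MonotoneOn ω₀ (Set.Icc 0 1) →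
        (∀ t ∈ Set.Icc (0 : ℝ) 1, 0 ≤ ω₀ t) →
        ∀ h : EuclideanSpace ℝ (Fin (n - 1)) → ℝ, Differentiable ℝ h →
          (∀ x' y' : EuclideanSpace ℝ (Fin (n - 1)), dist x' y' ≤ 1 →
            ‖fderiv ℝ h x' - fderiv ℝ h y'‖ ≤ ω₀ (dist x' y')) →
          ∀ x₀ : EuclideanSpace ℝ (Fin n), fderiv ℝ h (projE n x₀) = 0 →
            ∀ r ∈ Set.Ioc (0 : ℝ) 1,
              volume {x ∈ ball x₀ r |
                  (x (⟨n - 1, by omega⟩ : Fin n) - h (projE n x)) *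
                    (x (⟨n - 1, by omega⟩ : Fin n) - h (projE n x₀)) < 0} ≤
                ENNReal.ofReal (C * r ^ n * ω₀ r) := by
  refine ⟨2 ^ n, by positivity, ?_⟩
  intro ω₀ hω hω0 h hd hmod x₀ hx₀ r hr
  set l : Fin n := ⟨n - 1, by omega⟩
  set c : Fin n → ℝ := Function.update x₀ l (h (projE n x₀))
  set s : Fin n → ℝ := Function.update (fun _ => r) l (r * ω₀ r)
  have hsub : {x ∈ ball x₀ r | (x l - h (projE n x)) * (x l - h (projE n x₀)) < 0} ⊆
      {x : EuclideanSpace ℝ (Fin n) | ∀ i, |x i - c i| ≤ s i} := by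
    rintro x ⟨hx, hneg⟩ i
    by_cases hi : i = l
    · subst hi
      have hosc := abs_sub_le_of_fderiv_modulus hω hd hmod hx₀ hr
        (mem_ball.2 ((dist_projE_le n x x₀).trans_lt (mem_ball.1 hx)))
      simp only [c, s, Function.update_self]
      rw [abs_le] at hosc ⊢
      rcases mul_neg_iff.1 hneg with ⟨h₁, h₂⟩ | ⟨h₁, h₂⟩ <;> constructor <;> linarith
    · simp only [c, s, Function.update_of_ne hi]
      rw [← Real.dist_eq]
      exact (PiLp.dist_apply_le x x₀ i).trans (mem_ball.1 hx).le
  refine (measure_mono hsub).trans_eq ?_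
  have hs : ∀ i, 0 ≤ 2 * s i := by
    intro i
    have hωr := hω0 r ⟨hr.1.le, hr.2⟩
    have hr0 := hr.1.le
    by_cases hi : i = l
    · simp only [hi, s, Function.update_self]
      positivity
    · simp only [s, Function.update_of_ne hi]
      positivity
  rw [EuclideanSpace.volume_setOf_abs_sub_le, ← ENNReal.ofReal_prod_of_nonneg fun i _ => hs i,
    Finset.prod_mul_distrib, Finset.prod_update_of_mem (Finset.mem_univ l)]
  congr 1
  have hcard : (Finset.univ \ {l}).card = n - 1 := by
    simp [Finset.card_sdiff]
  rw [Finset.prod_const, Finset.prod_const, hcard, Finset.card_univ, Fintype.card_fin]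
  obtain ⟨m, rfl⟩ : ∃ m, n = m + 1 := ⟨n - 1, by omega⟩
  rw [Nat.add_sub_cancel]
  ring
end
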